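/- arXiv:2407.04546 — 3 statements merged into one kernel-verified Lean document; each statement's English description precedes it below -/
import Mathlib

section
/- Let ω ⊆ ℝ^{N−1} be a bounded open set. Then there exist λ > 0 and a smooth function v : ℝ^{N−1} → ℝ with compact support contained in ω such that ∫_ω ( ½|∇v(x')|² − v(x')⁴/4 + (λ/6) v(x')⁶ ) dx' < 0. -/
open MeasureTheory

/-- Partial derivative of `g : ℝ^m → ℝ` in the `i`-th coordinate direction. -/
noncomputable def pd {m : ℕ} (g : (Fin m → ℝ) → ℝ) (i : Fin m) (x : Fin m → ℝ) : ℝ :=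
  fderiv ℝ g x (Pi.single i 1)

/-- Laplacian of `g : ℝ^m → ℝ`. -/
noncomputable def lap {m : ℕ} (g : (Fin m → ℝ) → ℝ) (x : Fin m → ℝ) : ℝ :=
  ∑ i, fderiv ℝ (pd g i) x (Pi.single i 1)

/-- Partial derivative of `u : ℝ^m × ℝ → ℝ` in the `i`-th horizontal direction. -/
noncomputable def pdX {m : ℕ} (u : (Fin m → ℝ) × ℝ → ℝ) (i : Fin m)
    (p : (Fin m → ℝ) × ℝ) : ℝ :=
  fderiv ℝ u p (Pi.single i 1, 0)

/-- Partial derivative of `u : ℝ^m × ℝ → ℝ` in the last (vertical) direction. -/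
noncomputable def pdT {m : ℕ} (u : (Fin m → ℝ) × ℝ → ℝ) (p : (Fin m → ℝ) × ℝ) : ℝ :=
  fderiv ℝ u p (0, 1)

/-- Laplacian of `u : ℝ^m × ℝ → ℝ`. -/
noncomputable def lapC {m : ℕ} (u : (Fin m → ℝ) × ℝ → ℝ) (p : (Fin m → ℝ) × ℝ) : ℝ :=
  (∑ i, fderiv ℝ (pdX u i) p (Pi.single i 1, 0)) + fderiv ℝ (pdT u) p (0, 1)

/-- Primitive `F(t) = ∫₀ᵗ f(s) ds`. -/
noncomputable def primF (f : ℝ → ℝ) (t : ℝ) : ℝ := ∫ s in (0:ℝ)..t, f s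

/-- The action functional `I(v) = ∫_ω (½|∇v|² − F(v))`. -/
noncomputable def action {m : ℕ} (f : ℝ → ℝ) (ω : Set (Fin m → ℝ))
    (v : (Fin m → ℝ) → ℝ) : ℝ :=
  ∫ x in ω, ((1/2) * (∑ i, (pd v i x)^2) - primF f (v x))

/-- A set has smooth boundary if it is the strict sublevel set of a smooth defining function
whose gradient does not vanish on the boundary. -/
def HasSmoothBoundary {m : ℕ} (ω : Set (Fin m → ℝ)) : Prop :=
  ∃ ρ : (Fin m → ℝ) → ℝ, ContDiff ℝ (⊤ : ℕ∞) ρ ∧ ω = {x | ρ x < 0} ∧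
    frontier ω = {x | ρ x = 0} ∧ ∀ x ∈ frontier ω, fderiv ℝ ρ x ≠ 0

/-- Hypothesis (H1'): `f(0) = 0`, the action is nonnegative on Lipschitz functions vanishing
outside `ω`, and `0` is an isolated minimizer. -/
def H1' {m : ℕ} (f : ℝ → ℝ) (ω : Set (Fin m → ℝ)) : Prop :=
  f 0 = 0 ∧
  (∀ v : (Fin m → ℝ) → ℝ, (∃ K, LipschitzWith K v) → (∀ x ∉ ω, v x = 0) →
    0 ≤ action f ω v) ∧
  (∃ ε > (0:ℝ), ∀ v : (Fin m → ℝ) → ℝ, (∃ K, LipschitzWith K v) → (∀ x ∉ ω, v x = 0) →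
    0 < (∫ x in ω, ((∑ i, (pd v i x)^2) + (v x)^2)) →
    (∫ x in ω, ((∑ i, (pd v i x)^2) + (v x)^2)) ≤ ε → 0 < action f ω v)

/-- Hypothesis (H2'): there is a positive `C²` solution of `-Δψ = f(ψ)`, vanishing on `∂ω`,
with zero action. -/
def H2' {m : ℕ} (f : ℝ → ℝ) (ω : Set (Fin m → ℝ)) : Prop :=
  ∃ ψ : (Fin m → ℝ) → ℝ, ContDiffOn ℝ 2 ψ (closure ω) ∧ (∀ x ∈ ω, 0 < ψ x) ∧
    (∀ x ∈ frontier ω, ψ x = 0) ∧ (∀ x ∈ ω, -lap ψ x = f (ψ x)) ∧ action f ω ψ = 0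

/-- The Hamiltonian `H(t)` associated to `u` on the cylinder over `ω`. -/
noncomputable def Ham {m : ℕ} (f : ℝ → ℝ) (ω : Set (Fin m → ℝ))
    (u : (Fin m → ℝ) × ℝ → ℝ) (t : ℝ) : ℝ :=
  ∫ x' in ω, ((1/2) * ((∑ i, (pdX u i (x', t))^2) - (pdT u (x', t))^2) - primF f (u (x', t)))

lemma continuous_pd {m : ℕ} {g : (Fin m → ℝ) → ℝ} (hg : ContDiff ℝ (⊤ : ℕ∞) g) (i : Fin m) :
    Continuous (pd g i) :=
  (hg.continuous_fderiv (by simp)).clm_apply continuous_const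

lemma hasCompactSupport_pd {m : ℕ} {g : (Fin m → ℝ) → ℝ} (hg : HasCompactSupport g)
    (i : Fin m) : HasCompactSupport (pd g i) :=
  hg.fderiv_apply ℝ _

lemma pd_const_mul {m : ℕ} {g : (Fin m → ℝ) → ℝ} (hg : ContDiff ℝ (⊤ : ℕ∞) g) (t : ℝ)
    (i : Fin m) (x : Fin m → ℝ) : pd (fun y => t * g y) i x = t * pd g i x := by
  have h : DifferentiableAt ℝ g x := hg.differentiable (by simp) x
  simp [pd, fderiv_const_mul h]

lemma HasCompactSupport.pow {X : Type*} [TopologicalSpace X] {g : X → ℝ}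
    (hg : HasCompactSupport g) {k : ℕ} (hk : k ≠ 0) : HasCompactSupport (fun x => g x ^ k) :=
  hg.comp_left (g := fun y : ℝ => y ^ k) (zero_pow hk)

lemma exists_scaling_neg {A B C : ℝ} (hA : 0 ≤ A) (hB : 0 < B) (hC : 0 ≤ C) :
    ∃ lam t : ℝ, 0 < lam ∧ t ^ 2 * A - t ^ 4 * B + lam * t ^ 6 * C < 0 := by
  have hs : 0 < (A + 1) / B := by positivity
  set s := (A + 1) / B with hs_def
  have hsB : s * B = A + 1 := by rw [hs_def]; field_simp
  have hs2 : √s ^ 2 = s := Real.sq_sqrt hs.le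
  refine ⟨1 / (s ^ 2 * (C + 1)), √s, by positivity, ?_⟩
  have h4 : √s ^ 4 = s ^ 2 := by rw [show √s ^ 4 = (√s ^ 2) ^ 2 by ring, hs2]
  have h6 : √s ^ 6 = s ^ 3 := by rw [show √s ^ 6 = (√s ^ 2) ^ 3 by ring, hs2]
  rw [hs2, h4, h6]
  have hlam : 1 / (s ^ 2 * (C + 1)) * s ^ 3 * C = s - s / (C + 1) := by field_simp; ring
  have hpos : 0 < s / (C + 1) := by positivity
  have : s ^ 2 * B = s * A + s := by rw [pow_two, mul_assoc, hsB]; ring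
  linarith

/-- on any bounded open `ω` there are `λ > 0` and a smooth compactly supported
test function `v` with support in `ω` whose energy `I_λ(v)` is negative. -/
theorem negative_energy_test_function (N : ℕ) (hN : 2 ≤ N)
    (ω : Set (Fin (N - 1) → ℝ)) (hωo : IsOpen ω) (hωb : Bornology.IsBounded ω)
    (hωne : ω.Nonempty) :
    ∃ lam : ℝ, 0 < lam ∧
      ∃ v : (Fin (N - 1) → ℝ) → ℝ, ContDiff ℝ (⊤ : ℕ∞) v ∧ HasCompactSupport v ∧
        tsupport v ⊆ ω ∧
        (∫ x in ω,
          ((1/2) * (∑ i, (pd v i x)^2) - (v x)^4 / 4 + (lam / 6) * (v x)^6)) < 0 := by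
  obtain ⟨x₀, hx₀⟩ := hωne
  obtain ⟨φ, hφω, hφc, hφs, -, hφ1⟩ :=
    exists_contDiff_tsupport_subset (n := (⊤ : ℕ∞)) (hωo.mem_nhds hx₀)
  have hcont : Continuous φ := hφs.continuous
  have hpow_int (k : ℕ) (hk : k ≠ 0) : Integrable (fun x => φ x ^ k) (volume.restrict ω) :=
    ((hcont.pow k).integrable_of_hasCompactSupport (hφc.pow hk)).restrict
  have hgrad_int : Integrable (fun x => ∑ i, (pd φ i x) ^ 2) (volume.restrict ω) :=
    integrable_finsetSum _ fun i _ =>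
      (((continuous_pd hφs i).pow 2).integrable_of_hasCompactSupport
        ((hasCompactSupport_pd hφc i).pow two_ne_zero)).restrict
  have hB : 0 < ∫ x in ω, φ x ^ 4 := by
    rw [setIntegral_eq_integral_of_forall_compl_eq_zero fun x hx => by
      rw [image_eq_zero_of_notMem_tsupport fun h => hx (hφω h), zero_pow four_ne_zero]]
    exact (hcont.pow 4).integral_pos_of_hasCompactSupport_nonneg_nonzero
      (hφc.pow four_ne_zero) (fun x => by positivity) (x := x₀) (by simp [hφ1])
  obtain ⟨lam, t, hlam, hneg⟩ := exists_scaling_neg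
    (A := (1 / 2) * ∫ x in ω, ∑ i, (pd φ i x) ^ 2) (B := (∫ x in ω, φ x ^ 4) / 4)
    (C := (∫ x in ω, φ x ^ 6) / 6)
    (mul_nonneg (by norm_num) (integral_nonneg fun x => by positivity)) (by positivity)
    (div_nonneg (integral_nonneg fun x => by positivity) (by norm_num))
  refine ⟨lam, hlam, fun x => t * φ x, contDiff_const.mul hφs, hφc.mul_left,
    (tsupport_mul_subset_right).trans hφω, ?_⟩
  have hcongr : ∀ x, (1 / 2) * (∑ i, (pd (fun x => t * φ x) i x) ^ 2) - (t * φ x) ^ 4 / 4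
        + (lam / 6) * (t * φ x) ^ 6
      = t ^ 2 / 2 * (∑ i, (pd φ i x) ^ 2) - t ^ 4 / 4 * φ x ^ 4
        + lam * t ^ 6 / 6 * φ x ^ 6 := by
    intro x
    simp only [pd_const_mul hφs, mul_pow, ← Finset.mul_sum]
    ring
  simp only [hcongr]
  rw [integral_add (f := fun x => t ^ 2 / 2 * (∑ i, (pd φ i x) ^ 2) - t ^ 4 / 4 * φ x ^ 4)
      ((hgrad_int.const_mul _).sub ((hpow_int 4 four_ne_zero).const_mul _))
      ((hpow_int 6 (by norm_num)).const_mul _),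
    integral_sub (hgrad_int.const_mul _) ((hpow_int 4 four_ne_zero).const_mul _),
    integral_const_mul, integral_const_mul, integral_const_mul]
  linarith
end

section
/- Let ω ⊆ ℝ^{N−1} be a bounded open set with smooth boundary. Then there exists λ₀ > 0 such that for every λ ≥ λ₀ and every Lipschitz function v : ℝ^{N−1} → ℝ vanishing on ℝ^{N−1} ∖ ω, one has ∫_ω ( ½|∇v(x')|² − v(x')⁴/4 + (λ/6) v(x')⁶ ) dx' ≥ 0. -/
open MeasureTheory

/-- The square of a Lipschitz function with compact support is Lipschitz. -/
theorem LipschitzWith.exists_sq_of_hasCompactSupport {E : Type*} [PseudoMetricSpace E] {K : NNReal}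
    {v : E → ℝ} (hv : LipschitzWith K v) (hc : HasCompactSupport v) :
    ∃ D, LipschitzWith D (fun x => v x ^ 2) := by
  obtain ⟨M, hM⟩ := hv.continuous.bounded_above_of_compact_support hc
  refine ⟨Real.toNNReal (2 * |M|) * K, LipschitzWith.of_dist_le_mul fun x y => ?_⟩
  have h := hv.dist_le_mul x y
  rw [Real.dist_eq] at h ⊢
  have hx : |v x + v y| ≤ 2 * |M| := by
    have h₁ := (hM x).trans (le_abs_self M)
    have h₂ := (hM y).trans (le_abs_self M)
    rw [Real.norm_eq_abs] at h₁ h₂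
    linarith [abs_add_le (v x) (v y)]
  rw [sq_sub_sq, abs_mul, NNReal.coe_mul, Real.coe_toNNReal _ (by positivity), mul_assoc _ (K : ℝ)]
  gcongr

/-- The divergence theorem for the field `x ↦ xᵢ v(x)² eᵢ`, the density being integrable. -/
theorem LipschitzWith.integral_sq_add_coord_mul_pd {m : ℕ} {K : NNReal} {v : (Fin m → ℝ) → ℝ}
    (hv : LipschitzWith K v) (hc : HasCompactSupport v) (i : Fin m) :
    Integrable (fun x => v x ^ 2 + 2 * x i * v x * pd v i x) ∧
      ∫ x, (v x ^ 2 + 2 * x i * v x * pd v i x) = 0 := by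
  obtain ⟨D, hD⟩ := hv.exists_sq_of_hasCompactSupport hc
  have hv' := hv.continuous
  have hc2 : HasCompactSupport (fun x => v x ^ 2) :=
    hc.comp_left (g := fun t : ℝ => t ^ 2) (by simp)
  have hsq : Integrable (fun x => v x ^ 2) :=
    (hv'.pow 2).integrable_of_hasCompactSupport hc2
  have hpd : (fun x => lineDeriv ℝ v x (Pi.single i 1)) =ᵐ[volume] pd v i := by
    filter_upwards [hv.ae_differentiableAt (μ := volume)] with x hx
    exact hx.lineDeriv_eq_fderiv
  have hdrift : Integrable (fun x => 2 * x i * v x * pd v i x) := by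
    have hcont : Continuous fun x : Fin m → ℝ => 2 * x i * v x := by fun_prop
    refine ((hv.locallyIntegrable_lineDeriv (μ := volume)
      (Pi.single i 1)).integrable_smul_left_of_hasCompactSupport hcont
        (HasCompactSupport.mul_left hc)).congr ?_
    filter_upwards [hpd] with x hx
    rw [hx, smul_eq_mul]
  refine ⟨hsq.add hdrift, ?_⟩
  have hparts := LipschitzWith.integral_lineDeriv_mul_eq (μ := volume)
    (LipschitzWith.eval (α := fun _ : Fin m => ℝ) i) hD hc2 (Pi.single i 1)
  have hcoord : ∀ x : Fin m → ℝ,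
      lineDeriv ℝ (Function.eval i : (Fin m → ℝ) → ℝ) x (Pi.single i 1) = 1 := fun x => by
    have h := (ContinuousLinearMap.proj (R := ℝ) (φ := fun _ : Fin m => ℝ) i).hasFDerivAt (x := x)
    exact (h.hasLineDerivAt (Pi.single i 1)).lineDeriv.trans (by simp)
  have hright : ∫ x, lineDeriv ℝ (fun x => v x ^ 2) x (-Pi.single i 1) * Function.eval i x
      = ∫ x, -(2 * x i * v x * pd v i x) := by
    refine integral_congr_ae ?_
    filter_upwards [hv.ae_differentiableAt (μ := volume)] with x hx
    rw [(hx.hasFDerivAt.pow 2 |>.hasLineDerivAt (-Pi.single i 1)).lineDeriv]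
    simp [pd]
    ring
  rw [hright, integral_neg] at hparts
  simp only [hcoord, one_mul] at hparts
  rw [integral_add hsq hdrift, hparts, neg_add_cancel]

/-- for a bounded smooth domain `ω` there exists `λ₀ > 0` such that for every
`λ ≥ λ₀` the energy `I_λ` is nonnegative on all Lipschitz functions vanishing outside `ω`. -/
theorem energy_nonneg_large_lambda (N : ℕ) (hN : 2 ≤ N)
    (ω : Set (Fin (N - 1) → ℝ)) (hωo : IsOpen ω) (hωb : Bornology.IsBounded ω)
    (hωs : HasSmoothBoundary ω) :
    ∃ lam₀ : ℝ, 0 < lam₀ ∧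
      ∀ lam : ℝ, lam₀ ≤ lam →
        ∀ v : (Fin (N - 1) → ℝ) → ℝ, (∃ K, LipschitzWith K v) → (∀ x ∉ ω, v x = 0) →
          0 ≤ ∫ x in ω,
            ((1/2) * (∑ i, (pd v i x)^2) - (v x)^4 / 4 + (lam / 6) * (v x)^6) := by
  let i : Fin (N - 1) := ⟨0, by omega⟩
  obtain ⟨R, hR0, hR⟩ := hωb.exists_pos_norm_le
  refine ⟨3 * R ^ 2 / 4, by positivity, fun lam hlam v ⟨K, hv⟩ hvω => ?_⟩
  have hc : HasCompactSupport v :=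
    HasCompactSupport.intro' hωb.isCompact_closure isClosed_closure
      fun x hx => hvω x fun h => hx (subset_closure h)
  obtain ⟨hG, hG0⟩ := hv.integral_sq_add_coord_mul_pd hc i
  rw [← setIntegral_eq_integral_of_forall_compl_eq_zero (s := ω)
    fun x hx => by simp [hvω x hx]] at hG0
  by_cases hE : IntegrableOn (fun x =>
      (1/2) * (∑ i, (pd v i x)^2) - (v x)^4 / 4 + (lam / 6) * (v x)^6) ω
  swap
  · exact (integral_undef hE).ge
  have hadd := integral_add hE (hG.integrableOn.const_mul (1 / (4 * R ^ 2)))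
  rw [integral_const_mul, hG0, mul_zero, add_zero] at hadd
  rw [← hadd]
  refine setIntegral_nonneg hωo.measurableSet fun x hx => ?_
  have hxi : (x i) ^ 2 ≤ R ^ 2 := sq_le_sq' (by
    linarith [neg_abs_le (x i), norm_le_pi_norm x i, hR x hx, Real.norm_eq_abs (x i)]) (by
    linarith [le_abs_self (x i), norm_le_pi_norm x i, hR x hx, Real.norm_eq_abs (x i)])
  have hsum : (pd v i x) ^ 2 ≤ ∑ j, (pd v j x) ^ 2 :=
    Finset.single_le_sum (f := fun j => (pd v j x) ^ 2) (fun j _ => sq_nonneg _)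
      (Finset.mem_univ i)
  have hlow : (3 * R ^ 2 / 4) / 6 * v x ^ 6 ≤ lam / 6 * v x ^ 6 := by gcongr
  have hcoord : (x i) ^ 2 * v x ^ 2 / (8 * R ^ 4) ≤ v x ^ 2 / (8 * R ^ 2) := by
    rw [div_le_div_iff₀ (by positivity) (by positivity)]
    nlinarith [mul_le_mul_of_nonneg_right hxi (by positivity : 0 ≤ 8 * R ^ 2 * v x ^ 2)]
  have hsquares : 1 / 2 * (pd v i x) ^ 2 - v x ^ 4 / 4 + (3 * R ^ 2 / 4) / 6 * v x ^ 6
      + 1 / (4 * R ^ 2) * (v x ^ 2 + 2 * x i * v x * pd v i x)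
      = 1 / 2 * (pd v i x + x i * v x / (2 * R ^ 2)) ^ 2
        + v x ^ 2 * (1 / R - R * v x ^ 2) ^ 2 / 8
        + (v x ^ 2 / (8 * R ^ 2) - (x i) ^ 2 * v x ^ 2 / (8 * R ^ 4)) := by
    field_simp
    ring
  have hnonneg : 0 ≤ 1 / 2 * (pd v i x + x i * v x / (2 * R ^ 2)) ^ 2
      + v x ^ 2 * (1 / R - R * v x ^ 2) ^ 2 / 8 := by positivity
  linarith
end

section
/- There exist a smooth odd function f : ℝ → ℝ and a bounded smooth function u : [0,1] × ℝ → ℝ such that: −Δu = f(u) in (0,1) × ℝ; u = 0 on {0,1} × ℝ; ∇u is bounded on [0,1] × ℝ; ∇u(x) ≠ 0 for every x ∈ [0,1] × ℝ; and u is not one-dimensional, i.e. there do not exist a unit vector e ∈ ℝ² and a function g : ℝ → ℝ with u(x) = g(x·e) for all x ∈ [0,1] × ℝ. -/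
open MeasureTheory

/-- Partial derivative of `u : ℝ² → ℝ` in the first coordinate. -/
noncomputable def pd1 (u : ℝ × ℝ → ℝ) (p : ℝ × ℝ) : ℝ := fderiv ℝ u p (1, 0)

/-- Partial derivative of `u : ℝ² → ℝ` in the second coordinate. -/
noncomputable def pd2 (u : ℝ × ℝ → ℝ) (p : ℝ × ℝ) : ℝ := fderiv ℝ u p (0, 1)

/-- Laplacian of `u : ℝ² → ℝ`. -/
noncomputable def lap2 (u : ℝ × ℝ → ℝ) (p : ℝ × ℝ) : ℝ :=
  fderiv ℝ (pd1 u) p (1, 0) + fderiv ℝ (pd2 u) p (0, 1)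

/-- Gradient of `u : ℝ² → ℝ`. -/
noncomputable def grad2 (u : ℝ × ℝ → ℝ) (p : ℝ × ℝ) : ℝ × ℝ := (pd1 u p, pd2 u p)

namespace StripSolution

open Real Filter Topology
open scoped NNReal

/-- The space `ℓ¹(ℤ)` of summable real sequences. -/
abbrev SeqSp := lp (fun _ : ℤ => ℝ) 1

/-- The standard unit vectors of `ℓ¹(ℤ)`. -/
noncomputable def unitVec (k : ℤ) : SeqSp := lp.single 1 k 1

section Lift

variable {G : Type*} [NormedAddCommGroup G] [NormedSpace ℝ G]

lemma norm_unitVec (k : ℤ) : ‖unitVec k‖ = 1 := by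
  rw [unitVec, lp.norm_single (by norm_num)]; simp

lemma summable_abs (z : SeqSp) : Summable fun k => |z k| := by
  have := (lp.memℓp z).summable (by norm_num)
  simpa using this

lemma norm_eq_tsum (z : SeqSp) : ‖z‖ = ∑' k, |z k| := by
  rw [lp.norm_eq_tsum_rpow (by norm_num)]; simp

lemma hasSum_unitVec (z : SeqSp) : HasSum (fun k => z k • unitVec k) z := by
  have := lp.hasSum_single (p := 1) (by norm_num) z
  convert this using 2 with k
  rw [unitVec, ← lp.single_smul]; simp

lemma clm_ext {L L' : SeqSp →L[ℝ] G} (h : ∀ k, L (unitVec k) = L' (unitVec k)) : L = L' := by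
  ext z
  have h1 := (hasSum_unitVec z).mapL L
  have h2 := (hasSum_unitVec z).mapL L'
  simp only [map_smul, h] at h1 h2
  exact h1.unique h2

lemma clm_bound (L : SeqSp →L[ℝ] G) {c : ℝ} (h : ∀ k, ‖L (unitVec k)‖ ≤ c) (z : SeqSp) :
    ‖L z‖ ≤ c * ‖z‖ := by
  have h1 := (hasSum_unitVec z).mapL L
  simp only [map_smul] at h1
  rw [norm_eq_tsum, ← tsum_mul_left]
  refine h1.norm_le_of_bounded ((summable_abs z).mul_left c).hasSum fun k => ?_
  rw [norm_smul, Real.norm_eq_abs, mul_comm]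
  exact mul_le_mul_of_nonneg_right (h k) (abs_nonneg _)

lemma clm_opNorm_le (L : SeqSp →L[ℝ] G) {c : ℝ} (h : ∀ k, ‖L (unitVec k)‖ ≤ c) : ‖L‖ ≤ c :=
  L.opNorm_le_bound ((norm_nonneg _).trans (h 0)) (clm_bound L h)

variable [CompleteSpace G]

lemma lift_summable {g : ℤ → G} {c : ℝ} (hg : ∀ k, ‖g k‖ ≤ c) (z : SeqSp) :
    Summable fun k => z k • g k := by
  refine Summable.of_norm_bounded ((summable_abs z).mul_left c) fun k => ?_
  rw [norm_smul, Real.norm_eq_abs, mul_comm]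
  exact mul_le_mul_of_nonneg_right (hg k) (abs_nonneg _)

open Classical in
/-- The continuous linear map out of `ℓ¹(ℤ)` with prescribed bounded values on unit vectors
(zero if the family is unbounded). -/
noncomputable def lift (g : ℤ → G) : SeqSp →L[ℝ] G :=
  if h : ∃ c, ∀ k, ‖g k‖ ≤ c then
    LinearMap.mkContinuous
      { toFun := fun z => ∑' k, z k • g k
        map_add' := fun x y => by
          rw [← (lift_summable h.choose_spec x).tsum_add (lift_summable h.choose_spec y)]
          simp [add_smul]
        map_smul' := fun r x => by
          rw [RingHom.id_apply, ← (lift_summable h.choose_spec x).tsum_const_smul]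
          simp [mul_smul] }
      h.choose fun z => by
        change ‖∑' k, z k • g k‖ ≤ _
        rw [norm_eq_tsum, ← tsum_mul_left]
        refine (lift_summable h.choose_spec z).hasSum.norm_le_of_bounded
          ((summable_abs z).mul_left _).hasSum fun k => ?_
        rw [norm_smul, Real.norm_eq_abs, mul_comm]
        exact mul_le_mul_of_nonneg_right (h.choose_spec k) (abs_nonneg _)
  else 0

lemma lift_unitVec {g : ℤ → G} {c : ℝ} (hg : ∀ k, ‖g k‖ ≤ c) (k : ℤ) :
    lift g (unitVec k) = g k := by
  rw [lift, dif_pos ⟨c, hg⟩]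
  change ∑' j, (unitVec k) j • g j = g k
  rw [tsum_eq_single k]
  · simp [unitVec]
  · intro j hj
    simp [unitVec, hj]

end Lift

/-- Coordinate functionals. -/
noncomputable def coord (k : ℤ) : SeqSp →L[ℝ] ℝ := lp.evalCLM ℝ (fun _ : ℤ => ℝ) 1 k

lemma coord_apply (k : ℤ) (z : SeqSp) : coord k z = z k := rfl

lemma coord_unitVec (j k : ℤ) : coord j (unitVec k) = if j = k then 1 else 0 := by
  rw [coord_apply, unitVec]
  by_cases h : j = k
  · subst h; simp
  · simp [h]

lemma abs_coord_le (k : ℤ) (z : SeqSp) : |coord k z| ≤ ‖z‖ := by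
  have := lp.norm_apply_le_norm (p := 1) (by norm_num) z k
  simpa [coord_apply] using this

/-- Diagonal operators on `ℓ¹(ℤ)`. -/
noncomputable def diag (m : ℤ → ℝ) : SeqSp →L[ℝ] SeqSp := lift fun k => m k • unitVec k

lemma diag_unitVec {m : ℤ → ℝ} {c : ℝ} (hm : ∀ k, |m k| ≤ c) (k : ℤ) :
    diag m (unitVec k) = m k • unitVec k :=
  lift_unitVec (c := c) (fun k => by rw [norm_smul, norm_unitVec, mul_one]; exact hm k) k

lemma coord_diag {m : ℤ → ℝ} {c : ℝ} (hm : ∀ k, |m k| ≤ c) (k : ℤ) (z : SeqSp) :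
    coord k (diag m z) = m k * coord k z := by
  have : (coord k).comp (diag m) = m k • coord k := by
    refine clm_ext fun j => ?_
    simp only [ContinuousLinearMap.comp_apply, diag_unitVec hm, map_smul, coord_unitVec,
      smul_apply]
    by_cases h : k = j
    · simp [h]
    · simp [h]
  exact congrArg (fun L => L z) this

lemma seq_ext {z z' : SeqSp} (h : ∀ k, coord k z = coord k z') : z = z' := by
  ext k; exact h k

lemma norm_diag_le {m : ℤ → ℝ} {c : ℝ} (hm : ∀ k, |m k| ≤ c) : ‖diag m‖ ≤ c := by
  refine clm_opNorm_le _ fun k => ?_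
  rw [diag_unitVec hm, norm_smul, norm_unitVec, mul_one]; exact hm k

/-- The reflection `k ↦ -k`. -/
noncomputable def refl : SeqSp →L[ℝ] SeqSp := lift fun k => unitVec (-k)

lemma refl_unitVec (k : ℤ) : refl (unitVec k) = unitVec (-k) :=
  lift_unitVec (c := 1) (fun _ => (norm_unitVec _).le) k

lemma coord_refl (k : ℤ) (z : SeqSp) : coord k (refl z) = coord (-k) z := by
  have : (coord k).comp refl = coord (-k) := by
    refine clm_ext fun j => ?_
    simp only [ContinuousLinearMap.comp_apply, refl_unitVec, coord_unitVec, neg_eq_iff_eq_neg]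
  exact congrArg (fun L => L z) this

/-- The submultiplicative weights of the exponentially weighted convolution. -/
noncomputable def cw (r : ℝ) (j k : ℤ) : ℝ := r ^ (j + k).natAbs / (r ^ j.natAbs * r ^ k.natAbs)

lemma cw_nonneg {r : ℝ} (hr : 1 ≤ r) (j k : ℤ) : 0 ≤ cw r j k := by
  unfold cw; positivity

lemma cw_le_one {r : ℝ} (hr : 1 ≤ r) (j k : ℤ) : cw r j k ≤ 1 := by
  unfold cw
  rw [div_le_one (by positivity), ← pow_add]
  exact pow_le_pow_right₀ hr (Int.natAbs_add_le j k)

/-- Convolution in exponentially weighted coordinates. -/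
noncomputable def conv (r : ℝ) : SeqSp →L[ℝ] SeqSp →L[ℝ] SeqSp :=
  lift fun j => lift fun k => cw r j k • unitVec (j + k)

lemma norm_cw_smul {r : ℝ} (hr : 1 ≤ r) (j k : ℤ) : ‖cw r j k • unitVec (j + k)‖ ≤ 1 := by
  rw [norm_smul, norm_unitVec, mul_one, Real.norm_eq_abs, abs_of_nonneg (cw_nonneg hr j k)]
  exact cw_le_one hr j k

lemma norm_conv_aux {r : ℝ} (hr : 1 ≤ r) (j : ℤ) :
    ‖(lift fun k => cw r j k • unitVec (j + k) : SeqSp →L[ℝ] SeqSp)‖ ≤ 1 := by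
  refine clm_opNorm_le _ fun k => ?_
  rw [lift_unitVec (norm_cw_smul hr j)]
  exact norm_cw_smul hr j k

lemma conv_unitVec {r : ℝ} (hr : 1 ≤ r) (j k : ℤ) :
    conv r (unitVec j) (unitVec k) = cw r j k • unitVec (j + k) := by
  rw [conv, lift_unitVec (norm_conv_aux hr), lift_unitVec (norm_cw_smul hr j)]

lemma norm_conv_le {r : ℝ} (hr : 1 ≤ r) (a b : SeqSp) : ‖conv r a b‖ ≤ ‖a‖ * ‖b‖ := by
  have h : ‖conv r‖ ≤ 1 := by
    refine clm_opNorm_le _ fun j => ?_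
    rw [conv, lift_unitVec (norm_conv_aux hr)]
    exact norm_conv_aux hr j
  calc ‖conv r a b‖ ≤ ‖conv r‖ * ‖a‖ * ‖b‖ := (conv r).le_opNorm₂ a b
    _ ≤ 1 * ‖a‖ * ‖b‖ := by gcongr
    _ = _ := by rw [one_mul]

/-- Extensionality for pairs of continuous bilinear maps on `ℓ¹(ℤ)`. -/
lemma bilin_ext {G : Type*} [NormedAddCommGroup G] [NormedSpace ℝ G]
    {L L' : SeqSp →L[ℝ] SeqSp →L[ℝ] G}
    (h : ∀ j k, L (unitVec j) (unitVec k) = L' (unitVec j) (unitVec k)) (a b : SeqSp) :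
    L a b = L' a b := by
  have : L = L' := clm_ext fun j => clm_ext fun k => h j k
  rw [this]

lemma refl_conv {r : ℝ} (hr : 1 ≤ r) (a b : SeqSp) :
    refl (conv r a b) = conv r (refl a) (refl b) := by
  refine bilin_ext (L := (ContinuousLinearMap.compL ℝ SeqSp SeqSp SeqSp refl).comp (conv r))
    (L' := (conv r).bilinearComp refl refl) (fun j k => ?_) a b
  simp only [ContinuousLinearMap.comp_apply, ContinuousLinearMap.compL_apply,
    ContinuousLinearMap.bilinearComp_apply, refl_unitVec, conv_unitVec hr, map_smul]
  congr 1
  · simp only [cw, ← neg_add, Int.natAbs_neg]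
  · rw [neg_add]

/-- Change of exponential weight from `2` to `r`. -/
noncomputable def reweight (r : ℝ) : SeqSp →L[ℝ] SeqSp := diag fun k => (r / 2) ^ k.natAbs

lemma abs_reweight_le {r : ℝ} (hr : 1 ≤ r) (hr2 : r ≤ 2) (k : ℤ) :
    |(r / 2) ^ k.natAbs| ≤ 1 := by
  rw [abs_of_nonneg (by positivity)]
  exact pow_le_one₀ (by positivity) (by linarith)

lemma reweight_unitVec {r : ℝ} (hr : 1 ≤ r) (hr2 : r ≤ 2) (k : ℤ) :
    reweight r (unitVec k) = (r / 2) ^ k.natAbs • unitVec k :=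
  diag_unitVec (abs_reweight_le hr hr2) k

lemma reweight_conv {r : ℝ} (hr : 1 ≤ r) (hr2 : r ≤ 2) (a b : SeqSp) :
    reweight r (conv 2 a b) = conv r (reweight r a) (reweight r b) := by
  refine bilin_ext
    (L := (ContinuousLinearMap.compL ℝ SeqSp SeqSp SeqSp (reweight r)).comp (conv 2))
    (L' := (conv r).bilinearComp (reweight r) (reweight r)) (fun j k => ?_) a b
  simp only [ContinuousLinearMap.comp_apply, ContinuousLinearMap.compL_apply,
    ContinuousLinearMap.bilinearComp_apply, reweight_unitVec hr hr2, conv_unitVec hr,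
    conv_unitVec one_le_two, map_smul, smul_apply, smul_smul]
  congr 1
  have : r ≠ 0 := by positivity
  simp only [cw, div_pow]
  field_simp

/-- Values at unit vectors of the `n`-th derivative of the evaluation functional. -/
noncomputable def expCoeff (r : ℝ) (n : ℕ) (x : ℝ) (k : ℤ) : ℂ :=
  (Complex.I * k) ^ n * Complex.exp (Complex.I * k * x) * ((r ^ k.natAbs)⁻¹ : ℝ)

lemma norm_exp_I_mul (k : ℤ) (x : ℝ) : ‖Complex.exp (Complex.I * k * x)‖ = 1 := by
  have : Complex.I * k * x = ((k * x : ℝ) : ℂ) * Complex.I := by push_cast; ring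
  rw [this, Complex.norm_exp_ofReal_mul_I]

lemma norm_expCoeff {r : ℝ} (hr : 1 < r) (n : ℕ) (x : ℝ) (k : ℤ) :
    ‖expCoeff r n x k‖ = (k.natAbs : ℝ) ^ n * (r ^ k.natAbs)⁻¹ := by
  have h : 0 < r := by linarith
  simp only [expCoeff, norm_mul, norm_pow, norm_exp_I_mul, Complex.norm_I, one_mul, mul_one,
    Complex.norm_intCast, Complex.norm_real, Real.norm_eq_abs]
  rw [abs_of_pos (by positivity : 0 < (r ^ k.natAbs)⁻¹), Nat.cast_natAbs, Int.cast_abs]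

lemma exists_pow_mul_le {r : ℝ} (hr : 1 < r) (n : ℕ) :
    ∃ c : ℝ, 0 ≤ c ∧ ∀ m : ℕ, (m : ℝ) ^ n * (r ^ m)⁻¹ ≤ c := by
  have h := tendsto_pow_const_div_const_pow_of_one_lt n hr
  obtain ⟨c, hc⟩ := h.bddAbove_range
  refine ⟨c, ?_, fun m => ?_⟩
  · refine le_trans ?_ (hc ⟨0, rfl⟩)
    positivity
  · exact hc ⟨m, by simp [div_eq_mul_inv]⟩

lemma exists_expCoeff_le {r : ℝ} (hr : 1 < r) (n : ℕ) :
    ∃ c : ℝ, 0 ≤ c ∧ ∀ (x : ℝ) k, ‖expCoeff r n x k‖ ≤ c := by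
  obtain ⟨c, hc0, hc⟩ := exists_pow_mul_le hr n
  exact ⟨c, hc0, fun x k => by rw [norm_expCoeff hr]; exact hc _⟩

/-- The `n`-th derivative in `x` of the evaluation `z ↦ ∑ r ^ (-|k|) z_k exp (i k x)`. -/
noncomputable def expEval (r : ℝ) (n : ℕ) (x : ℝ) : SeqSp →L[ℝ] ℂ := lift (expCoeff r n x)

lemma expEval_unitVec {r : ℝ} (hr : 1 < r) (n : ℕ) (x : ℝ) (k : ℤ) :
    expEval r n x (unitVec k) = expCoeff r n x k := by
  obtain ⟨c, -, hc⟩ := exists_expCoeff_le hr n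
  exact lift_unitVec (hc x) k

lemma norm_exp_sub_le (t : ℝ) :
    ‖Complex.exp (Complex.I * t) - 1 - Complex.I * t‖ ≤ 3 * t ^ 2 := by
  have h1 : ‖Complex.I * t‖ = |t| := by simp
  by_cases ht : |t| ≤ 1
  · have := Complex.norm_exp_sub_one_sub_id_le (x := Complex.I * t) (by rw [h1]; exact ht)
    rw [h1, sq_abs] at this
    nlinarith [sq_nonneg t]
  · push Not at ht
    have h2 : ‖Complex.exp (Complex.I * t)‖ = 1 := by
      rw [mul_comm, Complex.norm_exp_ofReal_mul_I]
    calc _ ≤ ‖Complex.exp (Complex.I * t)‖ + ‖(1 : ℂ)‖ + ‖Complex.I * t‖ :=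
          (norm_sub_le _ _).trans (by gcongr; exact norm_sub_le _ _)
      _ = 2 + |t| := by rw [h1, h2, norm_one]; ring
      _ ≤ 3 * t ^ 2 := by rw [← sq_abs]; nlinarith

lemma hasDerivAt_expEval {r : ℝ} (hr : 1 < r) (n : ℕ) (x : ℝ) :
    HasDerivAt (expEval r n) (expEval r (n + 1) x) x := by
  obtain ⟨c, hc0, hc⟩ := exists_pow_mul_le hr (n + 2)
  have hr0 : 0 < r := by linarith
  rw [hasDerivAt_iff_isLittleO_nhds_zero]
  have key : ∀ h : ℝ, ‖expEval r n (x + h) - expEval r n x - h • expEval r (n + 1) x‖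
      ≤ 3 * c * ‖h ^ 2‖ := by
    intro h
    refine clm_opNorm_le _ fun k => ?_
    simp only [sub_apply, smul_apply, expEval_unitVec hr]
    have : expCoeff r n (x + h) k - expCoeff r n x k - h • expCoeff r (n + 1) x k
        = expCoeff r n x k * (Complex.exp (Complex.I * (k * h : ℝ)) - 1
          - Complex.I * (k * h : ℝ)) := by
      simp only [expCoeff, Complex.ofReal_add, mul_add, Complex.exp_add, Complex.real_smul]
      push_cast
      ring_nf
    rw [this, norm_mul, norm_expCoeff hr]
    calc _ ≤ (k.natAbs : ℝ) ^ n * (r ^ k.natAbs)⁻¹ * (3 * (k * h) ^ 2) := by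
          gcongr; exact norm_exp_sub_le _
      _ = 3 * ((k.natAbs : ℝ) ^ (n + 2) * (r ^ k.natAbs)⁻¹) * h ^ 2 := by
          have : (k.natAbs : ℝ) ^ 2 = (k : ℝ) ^ 2 := by
            rw [Nat.cast_natAbs, Int.cast_abs, sq_abs]
          rw [mul_pow, ← this]; ring
      _ ≤ 3 * c * h ^ 2 := by gcongr; exact hc _
      _ = _ := by rw [Real.norm_eq_abs, abs_of_nonneg (sq_nonneg h)]
  have h1 : (fun h : ℝ => expEval r n (x + h) - expEval r n x - h • expEval r (n + 1) x)
      =O[𝓝 0] fun h => h ^ 2 := Asymptotics.IsBigO.of_bound _ (Eventually.of_forall key)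
  exact h1.trans_isLittleO (by simpa using Asymptotics.isLittleO_pow_id (𝕜 := ℝ) one_lt_two)

lemma expEval_mul {r : ℝ} (hr : 1 < r) (x : ℝ) (a b : SeqSp) :
    expEval r 0 x (conv r a b) = expEval r 0 x a * expEval r 0 x b := by
  refine bilin_ext
    (L := (ContinuousLinearMap.compL ℝ SeqSp SeqSp ℂ (expEval r 0 x)).comp (conv r))
    (L' := (ContinuousLinearMap.mul ℝ ℂ).bilinearComp (expEval r 0 x) (expEval r 0 x))
    (fun j k => ?_) a b
  simp only [ContinuousLinearMap.comp_apply, ContinuousLinearMap.compL_apply,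
    ContinuousLinearMap.bilinearComp_apply, conv_unitVec hr.le, map_smul, expEval_unitVec hr,
    ContinuousLinearMap.mul_apply']
  have hr0 : (r : ℂ) ≠ 0 := by exact_mod_cast (by linarith : r ≠ 0)
  simp only [expCoeff, cw, Complex.real_smul, pow_zero, one_mul]
  push_cast
  rw [show Complex.I * ((j : ℂ) + k) * x = Complex.I * j * x + Complex.I * k * x by ring,
    Complex.exp_add]
  field_simp

lemma conj_expEval {r : ℝ} (hr : 1 < r) (x : ℝ) (a : SeqSp) :
    (starRingEnd ℂ) (expEval r 0 x a) = expEval r 0 x (refl a) := by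
  have : (Complex.conjCLE : ℂ →L[ℝ] ℂ).comp (expEval r 0 x) = (expEval r 0 x).comp refl := by
    refine clm_ext fun k => ?_
    simp only [ContinuousLinearMap.comp_apply, refl_unitVec, expEval_unitVec hr, expCoeff,
      ContinuousLinearEquiv.coe_coe, Complex.conjCLE_apply, pow_zero, one_mul, map_mul,
      ← Complex.exp_conj, Complex.conj_I, Complex.conj_ofReal, Int.natAbs_neg, Int.cast_neg]
    simp
  exact congrArg (fun L => L a) this

/-- The `n`-th derivative in `x` of the real evaluation functional
`z ↦ ½ ∑ r ^ (-|k|) z_k sin (k x)`. -/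
noncomputable def sinEval (r : ℝ) (n : ℕ) (x : ℝ) : SeqSp →L[ℝ] ℝ :=
  (1 / 2 : ℝ) • Complex.imCLM.comp (expEval r n x)

lemma sinEval_apply (r : ℝ) (n : ℕ) (x : ℝ) (z : SeqSp) :
    sinEval r n x z = 1 / 2 * (expEval r n x z).im := by
  simp [sinEval]

lemma hasDerivAt_sinEval {r : ℝ} (hr : 1 < r) (n : ℕ) (x : ℝ) :
    HasDerivAt (sinEval r n) (sinEval r (n + 1) x) x :=
  ((((ContinuousLinearMap.compL ℝ SeqSp ℂ ℝ) Complex.imCLM).hasFDerivAt.comp_hasDerivAt x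
    (hasDerivAt_expEval hr n x)).const_smul (1 / 2 : ℝ))

lemma contDiff_sinEval {r : ℝ} (hr : 1 < r) (n : ℕ) :
    ContDiff ℝ (⊤ : ℕ∞) (sinEval r n) := by
  rw [contDiff_infty]
  intro m
  induction m generalizing n with
  | zero =>
    exact contDiff_zero.2 (continuous_iff_continuousAt.2 fun x =>
      (hasDerivAt_sinEval hr n x).continuousAt)
  | succ m ih =>
    rw [show ((m + 1 : ℕ) : WithTop ℕ∞) = (m : WithTop ℕ∞) + 1 by norm_cast,
      contDiff_succ_iff_deriv]
    refine ⟨fun x => (hasDerivAt_sinEval hr n x).differentiableAt, by simp, ?_⟩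
    rw [show deriv (sinEval r n) = sinEval r (n + 1) from
      funext fun x => (hasDerivAt_sinEval hr n x).deriv]
    exact ih (n + 1)

lemma expCoeff_eq (r : ℝ) (n : ℕ) (x : ℝ) (k : ℤ) :
    expCoeff r n x k = Complex.I ^ n *
      (((k : ℝ) ^ n * (r ^ k.natAbs)⁻¹ * cos (k * x) : ℝ) +
        ((k : ℝ) ^ n * (r ^ k.natAbs)⁻¹ * sin (k * x) : ℝ) * Complex.I) := by
  have : Complex.I * k * x = ((k * x : ℝ) : ℂ) * Complex.I := by push_cast; ring
  rw [expCoeff, this, Complex.exp_mul_I, mul_pow, ← Complex.ofReal_cos, ← Complex.ofReal_sin]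
  push_cast
  ring

lemma im_add_mul_I (A B : ℝ) : ((A : ℂ) + B * Complex.I).im = B := by simp

lemma re_add_mul_I (A B : ℝ) : ((A : ℂ) + B * Complex.I).re = A := by simp

lemma sinEval_zero_unitVec {r : ℝ} (hr : 1 < r) (x : ℝ) (k : ℤ) :
    sinEval r 0 x (unitVec k) = 1 / 2 * ((r ^ k.natAbs)⁻¹ * sin (k * x)) := by
  rw [sinEval_apply, expEval_unitVec hr, expCoeff_eq, pow_zero, one_mul, im_add_mul_I,
    pow_zero, one_mul]

lemma sinEval_one_unitVec {r : ℝ} (hr : 1 < r) (x : ℝ) (k : ℤ) :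
    sinEval r 1 x (unitVec k) = 1 / 2 * (k * (r ^ k.natAbs)⁻¹ * cos (k * x)) := by
  rw [sinEval_apply, expEval_unitVec hr, expCoeff_eq, pow_one, Complex.I_mul_im, re_add_mul_I,
    pow_one]

lemma sinEval_two_unitVec {r : ℝ} (hr : 1 < r) (x : ℝ) (k : ℤ) :
    sinEval r 2 x (unitVec k) = -(k : ℝ) ^ 2 * sinEval r 0 x (unitVec k) := by
  rw [sinEval_zero_unitVec hr, sinEval_apply, expEval_unitVec hr, expCoeff_eq, Complex.I_sq,
    neg_one_mul, Complex.neg_im, im_add_mul_I]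
  ring

lemma natCast_le_pow (m : ℕ) : (m : ℝ) ≤ (3 / 2 : ℝ) ^ m := by
  rcases lt_or_ge m 2 with h | h
  · interval_cases m <;> norm_num
  · induction m, h using Nat.le_induction with
    | base => norm_num
    | succ m hm ih =>
      have : (2 : ℝ) ≤ m := by exact_mod_cast hm
      rw [pow_succ]; push_cast; linarith

lemma abs_sin_natCast_mul_le (m : ℕ) (x : ℝ) : |sin (m * x)| ≤ m * |sin x| := by
  induction m with
  | zero => simp
  | succ m ih =>
    push_cast
    rw [add_mul, one_mul, sin_add]
    calc _ ≤ |sin (m * x) * cos x| + |cos (m * x) * sin x| := abs_add_le _ _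
      _ = |sin (m * x)| * |cos x| + |cos (m * x)| * |sin x| := by rw [abs_mul, abs_mul]
      _ ≤ |sin (m * x)| * 1 + 1 * |sin x| := by
          gcongr
          · exact abs_cos_le_one x
          · exact abs_cos_le_one _
      _ ≤ _ := by linarith

lemma abs_sin_intCast_mul_le (k : ℤ) (x : ℝ) : |sin (k * x)| ≤ k.natAbs * |sin x| := by
  obtain ⟨m, rfl | rfl⟩ := k.eq_nat_or_neg
  · simpa using abs_sin_natCast_mul_le m x
  · simpa using abs_sin_natCast_mul_le m x

lemma natAbs_mul_inv_le (k : ℤ) : (k.natAbs : ℝ) * ((3 / 2 : ℝ) ^ k.natAbs)⁻¹ ≤ 1 := by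
  rw [← div_eq_mul_inv, div_le_one (by positivity)]
  exact natCast_le_pow _

lemma abs_sinEval_zero_le (x : ℝ) (z : SeqSp) :
    |sinEval (3 / 2) 0 x z| ≤ 1 / 2 * |sin x| * ‖z‖ := by
  refine clm_bound (sinEval (3 / 2) 0 x) (fun k => ?_) z
  rw [sinEval_zero_unitVec (by norm_num), Real.norm_eq_abs, abs_mul, abs_mul,
    abs_of_pos (by positivity : (0 : ℝ) < ((3 / 2 : ℝ) ^ k.natAbs)⁻¹),
    abs_of_pos (by norm_num : (0 : ℝ) < 1 / 2)]
  gcongr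
  calc _ ≤ ((3 / 2 : ℝ) ^ k.natAbs)⁻¹ * (k.natAbs * |sin x|) := by
        gcongr; exact abs_sin_intCast_mul_le k x
    _ = (k.natAbs * ((3 / 2 : ℝ) ^ k.natAbs)⁻¹) * |sin x| := by ring
    _ ≤ 1 * |sin x| := by gcongr; exact natAbs_mul_inv_le k
    _ = _ := one_mul _

lemma abs_sinEval_one_le (x : ℝ) (z : SeqSp) :
    |sinEval (3 / 2) 1 x z| ≤ 1 / 2 * ‖z‖ := by
  refine clm_bound (sinEval (3 / 2) 1 x) (fun k => ?_) z
  rw [sinEval_one_unitVec (by norm_num), Real.norm_eq_abs, abs_mul, abs_mul, abs_mul,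
    abs_of_pos (by positivity : (0 : ℝ) < ((3 / 2 : ℝ) ^ k.natAbs)⁻¹),
    abs_of_pos (by norm_num : (0 : ℝ) < 1 / 2), ← Int.cast_abs, ← Nat.cast_natAbs]
  calc _ ≤ 1 / 2 * (1 * 1 : ℝ) := by
        gcongr
        · exact natAbs_mul_inv_le k
        · exact abs_cos_le_one _
    _ = _ := by norm_num

lemma sinEval_two {r : ℝ} (hr : 1 < r) {z z' : SeqSp}
    (h : ∀ k : ℤ, coord k z' = -(k : ℝ) ^ 2 * coord k z) (x : ℝ) :
    sinEval r 2 x z = sinEval r 0 x z' := by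
  have h1 := (hasSum_unitVec z).mapL (sinEval r 2 x)
  have h2 := (hasSum_unitVec z').mapL (sinEval r 0 x)
  refine h1.unique (h2.congr_fun ?_)
  intro k
  have := h k
  rw [coord_apply, coord_apply] at this
  simp only [map_smul, smul_eq_mul, sinEval_two_unitVec hr, this]
  ring

/-- The third convolution power. -/
noncomputable def cube (r : ℝ) (a : SeqSp) : SeqSp := conv r a (conv r a a)

/-- The fifth convolution power. -/
noncomputable def quint (r : ℝ) (a : SeqSp) : SeqSp := conv r a (conv r a (cube r a))

lemma refl_cube {r : ℝ} (hr : 1 ≤ r) {a : SeqSp} (ha : refl a = -a) :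
    refl (cube r a) = -cube r a := by
  simp [cube, refl_conv hr, ha]

lemma refl_quint {r : ℝ} (hr : 1 ≤ r) {a : SeqSp} (ha : refl a = -a) :
    refl (quint r a) = -quint r a := by
  simp [quint, refl_conv hr, ha, refl_cube hr ha]

lemma expEval_eq {r : ℝ} (hr : 1 < r) (x : ℝ) {a : SeqSp} (ha : refl a = -a) :
    expEval r 0 x a = ((2 * sinEval r 0 x a : ℝ) : ℂ) * Complex.I := by
  have h := conj_expEval hr x a
  rw [ha, map_neg] at h
  have hre : (expEval r 0 x a).re = 0 := by
    have := congrArg Complex.re h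
    simp only [Complex.conj_re, Complex.neg_re] at this
    linarith
  apply Complex.ext
  · simp [hre]
  · simp [sinEval_apply]

lemma sinEval_cube {r : ℝ} (hr : 1 < r) (x : ℝ) {a : SeqSp} (ha : refl a = -a) :
    sinEval r 0 x (cube r a) = -4 * sinEval r 0 x a ^ 3 := by
  rw [sinEval_apply, cube, expEval_mul hr, expEval_mul hr, expEval_eq hr x ha]
  have : ∀ t : ℝ, ((t : ℂ) * Complex.I * (t * Complex.I * (t * Complex.I))) =
      ((-t ^ 3 : ℝ) : ℂ) * Complex.I := by
    intro t; push_cast; linear_combination (t : ℂ) ^ 3 * Complex.I * Complex.I_sq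
  rw [this, Complex.im_ofReal_mul, Complex.I_im]
  ring

lemma sinEval_quint {r : ℝ} (hr : 1 < r) (x : ℝ) {a : SeqSp} (ha : refl a = -a) :
    sinEval r 0 x (quint r a) = 16 * sinEval r 0 x a ^ 5 := by
  rw [sinEval_apply, quint, expEval_mul hr, expEval_mul hr,
    expEval_eq hr x (refl_cube hr.le ha), expEval_eq hr x ha, sinEval_cube hr x ha]
  generalize sinEval r 0 x a = t
  have : (((2 * t : ℝ) : ℂ) * Complex.I * (((2 * t : ℝ) : ℂ) * Complex.I *
      (((2 * (-4 * t ^ 3) : ℝ) : ℂ) * Complex.I))) = ((32 * t ^ 5 : ℝ) : ℂ) * Complex.I := by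
    push_cast; linear_combination (-32 * (t : ℂ) ^ 5 * Complex.I) * Complex.I_sq
  rw [this, Complex.im_ofReal_mul, Complex.I_im]
  ring

lemma affine_of_hasDerivAt {d e : ℝ → ℝ} (h1 : ∀ y, HasDerivAt d (e y) y)
    (h2 : ∀ y, HasDerivAt e 0 y) (y : ℝ) : d y = d 0 + y * (d 1 - d 0) := by
  have he : ∀ y, e y = e 0 := fun y =>
    is_const_of_deriv_eq_zero (fun y => (h2 y).differentiableAt) (fun y => (h2 y).deriv) y 0
  have h3 : ∀ y, HasDerivAt (fun y => d y - y * e 0) 0 y := fun y => by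
    exact ((h1 y).sub ((hasDerivAt_id y).mul_const (e 0))).congr_deriv (by simp [he y])
  have h4 : ∀ y, d y - y * e 0 = d 0 - 0 * e 0 := fun y =>
    is_const_of_deriv_eq_zero (fun y => (h3 y).differentiableAt) (fun y => (h3 y).deriv) y 0
  have h5 := h4 1
  have h6 := h4 y
  have h7 : e 0 = d 1 - d 0 := by linarith
  rw [← h7]; linarith

/-- A curve in `ℓ¹(ℤ)` whose coordinates have second derivatives given by a continuous curve is
itself twice differentiable. -/
lemma twice_differentiable_of_coord {v G : ℝ → SeqSp} (hG : Continuous G) {w : ℤ → ℝ → ℝ}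
    (h1 : ∀ k y, HasDerivAt (fun y => coord k (v y)) (w k y) y)
    (h2 : ∀ k y, HasDerivAt (w k) (coord k (G y)) y) :
    ∃ z : ℝ → SeqSp, (∀ y, HasDerivAt v (z y) y) ∧ ∀ y, HasDerivAt z (G y) y := by
  set Φ : ℝ → SeqSp := fun y => ∫ t in (0 : ℝ)..y, G t with hΦ
  have dΦ : ∀ y, HasDerivAt Φ (G y) y := fun y => hG.integral_hasStrictDerivAt 0 y |>.hasDerivAt
  have cΦ : Continuous Φ := continuous_iff_continuousAt.2 fun y => (dΦ y).continuousAt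
  set Ψ : ℝ → SeqSp := fun y => ∫ t in (0 : ℝ)..y, Φ t with hΨ
  have dΨ : ∀ y, HasDerivAt Ψ (Φ y) y := fun y => cΦ.integral_hasStrictDerivAt 0 y |>.hasDerivAt
  set c : SeqSp := (v 1 - Ψ 1) - (v 0 - Ψ 0)
  have hv : v = fun y => v 0 - Ψ 0 + y • c + Ψ y := by
    funext y
    refine seq_ext fun k => ?_
    have := affine_of_hasDerivAt (d := fun y => coord k (v y) - coord k (Ψ y))
      (e := fun y => w k y - coord k (Φ y))
      (fun y => (h1 k y).sub ((coord k).hasFDerivAt.comp_hasDerivAt y (dΨ y)))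
      (fun y => ((h2 k y).sub ((coord k).hasFDerivAt.comp_hasDerivAt y (dΦ y))).congr_deriv
        (sub_self _)) y
    simp only [map_add, map_sub, map_smul, smul_eq_mul, c]
    linarith
  refine ⟨fun y => c + Φ y, fun y => ?_, fun y => (dΦ y).const_add c⟩
  rw [hv]
  exact ((((hasDerivAt_id y).smul_const c).const_add (v 0 - Ψ 0)).add (dΨ y)).congr_deriv
    (by simp)

lemma contDiff_add_two {v z G : ℝ → SeqSp} (h1 : ∀ y, HasDerivAt v (z y) y)
    (h2 : ∀ y, HasDerivAt z (G y) y) {n : ℕ} (hG : ContDiff ℝ n G) : ContDiff ℝ (n + 2 : ℕ) v := by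
  have hz : ContDiff ℝ (n + 1 : ℕ) z := by
    rw [show ((n + 1 : ℕ) : WithTop ℕ∞) = (n : WithTop ℕ∞) + 1 by norm_cast,
      contDiff_succ_iff_deriv]
    refine ⟨fun y => (h2 y).differentiableAt, by simp, ?_⟩
    rwa [show deriv z = G from funext fun y => (h2 y).deriv]
  rw [show ((n + 2 : ℕ) : WithTop ℕ∞) = ((n + 1 : ℕ) : WithTop ℕ∞) + 1 by norm_cast,
    contDiff_succ_iff_deriv]
  refine ⟨fun y => (h1 y).differentiableAt, by simp, ?_⟩
  rwa [show deriv v = z from funext fun y => (h1 y).deriv]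

/-- The bounded solution of `ε² V'' = N² V - g` on the line. -/
lemma exists_deriv_resolvent {N ε : ℝ} (hN : 0 < N) (hε : 0 < ε) {g : ℝ → ℝ} (hg : Continuous g)
    {C : ℝ} (hC : ∀ t, |g t| ≤ C) {V : ℝ → ℝ}
    (hV : ∀ y, V y = ∫ t, exp (-N * |t|) / (2 * N) * g (y - ε * t)) :
    ∃ V' : ℝ → ℝ, (∀ y, HasDerivAt V (V' y) y) ∧
      ∀ y, HasDerivAt V' ((N ^ 2 * V y - g y) / ε ^ 2) y := by
  set l := N / ε with hl
  have hl0 : 0 < l := by positivity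
  set c := 1 / (2 * N * ε) with hc
  have cA : Continuous fun t => exp (l * t) * g t := by fun_prop
  have cB : Continuous fun t => exp (-l * t) * g t := by fun_prop
  have iA : ∀ y, IntegrableOn (fun t => exp (l * t) * g t) (Set.Iic y) := fun y =>
    (integrableOn_exp_mul_Iic hl0 y).mul_bdd hg.aestronglyMeasurable
      (Eventually.of_forall hC)
  have iB : ∀ y, IntegrableOn (fun t => exp (-l * t) * g t) (Set.Ioi y) := fun y =>
    (integrableOn_exp_mul_Ioi (neg_lt_zero.2 hl0) y).mul_bdd hg.aestronglyMeasurable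
      (Eventually.of_forall hC)
  set A : ℝ → ℝ := fun y => ∫ t in Set.Iic y, exp (l * t) * g t with hA
  set B : ℝ → ℝ := fun y => ∫ t in Set.Ioi y, exp (-l * t) * g t with hB
  have dA : ∀ y, HasDerivAt A (exp (l * y) * g y) y := by
    intro y
    have : A = fun y => A 0 + ∫ t in (0 : ℝ)..y, exp (l * t) * g t := by
      funext y
      rw [← intervalIntegral.integral_Iic_sub_Iic (iA 0) (iA y)]; simp [hA]
    rw [this]
    exact ((cA.integral_hasStrictDerivAt 0 y).hasDerivAt).const_add _
  have dB : ∀ y, HasDerivAt B (-(exp (-l * y) * g y)) y := by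
    intro y
    have : B = fun y => B 0 - ∫ t in (0 : ℝ)..y, exp (-l * t) * g t := by
      funext y
      rw [← intervalIntegral.integral_Ioi_sub_Ioi' (iB 0) (iB y)]; simp [hB]
    rw [this]
    exact ((cB.integral_hasStrictDerivAt 0 y).hasDerivAt).const_sub _
  have eV : ∀ y, V y = c * (exp (-l * y) * A y + exp (l * y) * B y) := by
    intro y
    set K : ℝ → ℝ := fun s => exp (-l * |y - s|) * g s with hK
    have h1 : V y = ∫ t, 1 / (2 * N) * K (y - ε * t) := by
      rw [hV]
      refine integral_congr_ae (Eventually.of_forall fun t => ?_)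
      simp only [hK, sub_sub_cancel, abs_mul, abs_of_pos hε]
      rw [show -l * (ε * |t|) = -N * |t| by rw [hl]; field_simp]
      ring
    have h2 : ∫ t, K (y - ε * t) = ε⁻¹ * ∫ t, K t := by
      rw [Measure.integral_comp_mul_left (fun t => K (y - t)) ε, integral_sub_left_eq_self K,
        abs_of_pos (by positivity), smul_eq_mul]
    have h3 : ∀ t ∈ Set.Iic y, K t = exp (-l * y) * (exp (l * t) * g t) := by
      intro t ht
      simp only [hK]
      rw [abs_of_nonneg (sub_nonneg.2 ht), ← mul_assoc, ← exp_add]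
      ring_nf
    have h4 : ∀ t ∈ Set.Ioi y, K t = exp (l * y) * (exp (-l * t) * g t) := by
      intro t ht
      simp only [hK]
      rw [abs_of_neg (sub_neg.2 ht), ← mul_assoc, ← exp_add]
      ring_nf
    have h5 : ∫ t, K t = exp (-l * y) * A y + exp (l * y) * B y := by
      rw [← intervalIntegral.integral_Iic_add_Ioi (b := y) (f := K)
        (IntegrableOn.congr_fun ((iA y).const_mul _) (fun t ht => (h3 t ht).symm) measurableSet_Iic)
        (IntegrableOn.congr_fun ((iB y).const_mul _) (fun t ht => (h4 t ht).symm)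
          measurableSet_Ioi),
        setIntegral_congr_fun measurableSet_Iic h3, setIntegral_congr_fun measurableSet_Ioi h4,
        integral_const_mul, integral_const_mul]
    rw [h1, integral_const_mul, h2, h5, hc]
    field_simp
  have dE : ∀ l' y : ℝ, HasDerivAt (fun y => exp (l' * y)) (exp (l' * y) * l') y := fun l' y => by
    simpa using ((hasDerivAt_id y).const_mul l').exp
  have ee : ∀ y, exp (-l * y) * exp (l * y) = 1 := fun y => by
    rw [← exp_add]; simp
  refine ⟨fun y => c * l * (exp (l * y) * B y - exp (-l * y) * A y), fun y => ?_, fun y => ?_⟩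
  · rw [funext eV]
    refine ((((dE (-l) y).mul (dA y)).add ((dE l y).mul (dB y))).const_mul c).congr_deriv ?_
    ring
  · refine ((((dE l y).mul (dB y)).sub ((dE (-l) y).mul (dA y))).const_mul (c * l)).congr_deriv ?_
    rw [eV]
    have h1 : c * l * 2 = 1 / ε ^ 2 := by rw [hc, hl]; field_simp
    have h2 : N ^ 2 = l ^ 2 * ε ^ 2 := by rw [hl]; field_simp
    have h3 : ∀ W G : ℝ, (N ^ 2 * W - G) / ε ^ 2 = l ^ 2 * W - c * l * 2 * G := by
      intro W G
      rw [h1, h2]; field_simp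
    rw [h3]
    linear_combination (-2 * c * l * g y) * ee y

/-- Projection of the line onto the unit interval. -/
noncomputable def clamp (s : ℝ) : ℝ := max 0 (min s 1)

lemma clamp_mem (s : ℝ) : clamp s ∈ Set.Icc (0 : ℝ) 1 :=
  ⟨le_max_left _ _, max_le zero_le_one (min_le_right _ _)⟩

lemma clamp_of_mem {s : ℝ} (h : s ∈ Set.Icc (0 : ℝ) 1) : clamp s = s := by
  rw [clamp, min_eq_left h.2, max_eq_right h.1]

lemma abs_clamp_sub_le (s t : ℝ) : |clamp s - clamp t| ≤ |s - t| := by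
  have h1 := abs_max_sub_max_le_abs (min s 1) (min t 1) 0
  have h2 := abs_min_sub_min_le_max s 1 t 1
  rw [clamp, clamp, max_comm 0, max_comm 0]
  refine h1.trans (h2.trans ?_)
  simp

lemma continuous_clamp : Continuous clamp := by unfold clamp; fun_prop

/-- The unperturbed force, the derivative of `s ^ 2 * (1 - s ^ 2) ^ 2 / 2`. -/
noncomputable def refForce (s : ℝ) : ℝ := s - 4 * s ^ 3 + 3 * s ^ 5

/-- Forces close to the unperturbed one, with the same zeros and zero mean. -/
structure NearForce (H : ℝ → ℝ) : Prop where
  cont : Continuous H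
  left : ∀ s ∈ Set.Icc (0 : ℝ) 1, |H s - refForce s| ≤ 1 / 50 * s
  right : ∀ s ∈ Set.Icc (0 : ℝ) 1, |H s - refForce s| ≤ 1 / 50 * (1 - s)
  mean : ∫ s in (0 : ℝ)..1, H s = 0

/-- The potential of a force. -/
noncomputable def pot (H : ℝ → ℝ) (s : ℝ) : ℝ := ∫ t in (0 : ℝ)..s, H t

/-- The speed of the heteroclinic orbit. -/
noncomputable def speed (H : ℝ → ℝ) (s : ℝ) : ℝ := √(2 * pot H (clamp s))

lemma hasDerivAt_pot {H : ℝ → ℝ} (hH : Continuous H) (s : ℝ) : HasDerivAt (pot H) (H s) s :=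
  (hH.integral_hasStrictDerivAt 0 s).hasDerivAt

lemma continuous_refForce : Continuous refForce := by unfold refForce; fun_prop

lemma integral_refForce (s : ℝ) : ∫ t in (0 : ℝ)..s, refForce t = s ^ 2 * (1 - s ^ 2) ^ 2 / 2 := by
  have h : ∀ t : ℝ, HasDerivAt (fun t : ℝ => t ^ 2 / 2 - t ^ 4 + t ^ 6 / 2) (refForce t) t := by
    intro t
    refine ((((hasDerivAt_pow 2 t).div_const 2).sub (hasDerivAt_pow 4 t)).add
      ((hasDerivAt_pow 6 t).div_const 2)).congr_deriv ?_
    simp only [refForce]; push_cast; ring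
  rw [intervalIntegral.integral_eq_sub_of_hasDerivAt (fun t _ => h t)
    (continuous_refForce.intervalIntegrable _ _)]
  ring

lemma NearForce.pot_eq_right {H : ℝ → ℝ} (hH : NearForce H) (s : ℝ) :
    pot H s = -∫ t in s..1, H t := by
  have := intervalIntegral.integral_add_adjacent_intervals
    (hH.cont.intervalIntegrable 0 s) (hH.cont.intervalIntegrable (μ := volume) s 1)
  rw [hH.mean] at this
  rw [pot]; linarith

lemma NearForce.abs_pot_sub_left {H : ℝ → ℝ} (hH : NearForce H) {s : ℝ}
    (hs : s ∈ Set.Icc (0 : ℝ) 1) :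
    |pot H s - s ^ 2 * (1 - s ^ 2) ^ 2 / 2| ≤ 1 / 100 * s ^ 2 := by
  rw [← integral_refForce, pot, ← intervalIntegral.integral_sub (hH.cont.intervalIntegrable _ _)
    (continuous_refForce.intervalIntegrable _ _)]
  have h1 := intervalIntegral.norm_integral_le_of_norm_le (μ := volume) hs.1
    (f := fun t => H t - refForce t) (g := fun t => 1 / 50 * t)
    (Eventually.of_forall fun t ht => hH.left t ⟨ht.1.le, ht.2.trans hs.2⟩)
    (by apply Continuous.intervalIntegrable; fun_prop)
  rw [intervalIntegral.integral_const_mul, integral_id] at h1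
  rw [Real.norm_eq_abs] at h1
  linarith

lemma NearForce.abs_pot_sub_right {H : ℝ → ℝ} (hH : NearForce H) {s : ℝ}
    (hs : s ∈ Set.Icc (0 : ℝ) 1) :
    |pot H s - s ^ 2 * (1 - s ^ 2) ^ 2 / 2| ≤ 1 / 100 * (1 - s) ^ 2 := by
  have h2 : s ^ 2 * (1 - s ^ 2) ^ 2 / 2 = -∫ t in s..1, refForce t := by
    have := intervalIntegral.integral_add_adjacent_intervals
      (continuous_refForce.intervalIntegrable 0 s)
      (continuous_refForce.intervalIntegrable (μ := volume) s 1)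
    rw [integral_refForce, integral_refForce] at this
    linarith
  rw [h2, hH.pot_eq_right, neg_sub_neg, abs_sub_comm,
    ← intervalIntegral.integral_sub (hH.cont.intervalIntegrable _ _)
    (continuous_refForce.intervalIntegrable _ _)]
  have h1 := intervalIntegral.norm_integral_le_of_norm_le (μ := volume) hs.2
    (f := fun t => H t - refForce t) (g := fun t => 1 / 50 * (1 - t))
    (Eventually.of_forall fun t ht => hH.right t ⟨hs.1.trans ht.1.le, ht.2⟩)
    (by apply Continuous.intervalIntegrable; fun_prop)
  have h3 : ∫ t in s..1, (1 - t) = (1 - s) ^ 2 / 2 := by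
    rw [intervalIntegral.integral_sub intervalIntegrable_const
      intervalIntegral.intervalIntegrable_id, integral_id, intervalIntegral.integral_const,
      smul_eq_mul]
    ring
  rw [intervalIntegral.integral_const_mul, h3, Real.norm_eq_abs] at h1
  linarith

lemma NearForce.le_pot {H : ℝ → ℝ} (hH : NearForce H) {s : ℝ} (hs : s ∈ Set.Icc (0 : ℝ) 1) :
    (s * (1 - s)) ^ 2 / 4 ≤ pot H s := by
  have h0 : (s * (1 - s)) ^ 2 / 2 ≤ s ^ 2 * (1 - s ^ 2) ^ 2 / 2 := by
    have : s ^ 2 * (1 - s ^ 2) ^ 2 = (s * (1 - s)) ^ 2 * (1 + s) ^ 2 := by ring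
    rw [this]
    have := mul_le_mul_of_nonneg_left (by nlinarith [hs.1] : (1 : ℝ) ≤ (1 + s) ^ 2)
      (sq_nonneg (s * (1 - s)))
    linarith
  rcases le_total s (1 / 2) with h | h
  · have h1 := (abs_le.1 (hH.abs_pot_sub_left hs)).1
    have h2 : s ^ 2 * (1 / 4) ≤ s ^ 2 * (1 - s) ^ 2 := by
      gcongr; nlinarith
    rw [mul_pow] at *
    linarith [mul_nonneg (sq_nonneg s) (sq_nonneg (1 - s))]
  · have h1 := (abs_le.1 (hH.abs_pot_sub_right hs)).1
    have h2 : 1 / 4 * (1 - s) ^ 2 ≤ s ^ 2 * (1 - s) ^ 2 := by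
      gcongr; nlinarith
    rw [mul_pow] at *
    linarith [mul_nonneg (sq_nonneg s) (sq_nonneg (1 - s))]

lemma NearForce.abs_le {H : ℝ → ℝ} (hH : NearForce H) {s : ℝ} (hs : s ∈ Set.Icc (0 : ℝ) 1) :
    |H s| ≤ 5 * (s * (1 - s)) := by
  obtain ⟨h0, h1⟩ := hs
  have e1 : |refForce s| ≤ 4 * (s * (1 - s)) := by
    have : refForce s = s * (1 - s) * ((1 + s) * (1 - 3 * s ^ 2)) := by
      rw [refForce]; ring
    rw [this, abs_mul, abs_of_nonneg (mul_nonneg h0 (by linarith)), mul_comm 4]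
    refine mul_le_mul_of_nonneg_left ?_ (mul_nonneg h0 (by linarith))
    have h2 : 0 ≤ s ^ 2 := sq_nonneg s
    have h3 : s ^ 2 ≤ 1 := by nlinarith
    rw [_root_.abs_le]
    constructor <;> nlinarith [mul_nonneg h0 h2, mul_nonneg h0 (sub_nonneg.2 h3)]
  have e2 : |H s - refForce s| ≤ s * (1 - s) := by
    have a1 := hH.left s ⟨h0, h1⟩
    have a2 := hH.right s ⟨h0, h1⟩
    rcases le_total s (1 / 2) with h | h <;> nlinarith
  calc |H s| = |(H s - refForce s) + refForce s| := by ring_nf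
    _ ≤ _ := abs_add_le _ _
    _ ≤ _ := by linarith

lemma NearForce.le_speed {H : ℝ → ℝ} (hH : NearForce H) {s : ℝ} (hs : s ∈ Set.Icc (0 : ℝ) 1) :
    s * (1 - s) / 2 ≤ speed H s := by
  rw [speed, clamp_of_mem hs]
  refine Real.le_sqrt_of_sq_le ?_
  have := hH.le_pot hs
  nlinarith [sq_nonneg (s * (1 - s))]

lemma NearForce.speed_pos {H : ℝ → ℝ} (hH : NearForce H) {s : ℝ} (hs : s ∈ Set.Ioo (0 : ℝ) 1) :
    0 < speed H s :=
  (by nlinarith [mul_pos hs.1 (sub_pos.2 hs.2)] : 0 < s * (1 - s) / 2).trans_le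
    (hH.le_speed ⟨hs.1.le, hs.2.le⟩)

lemma NearForce.hasDerivAt_speed {H : ℝ → ℝ} (hH : NearForce H) {s : ℝ}
    (hs : s ∈ Set.Ioo (0 : ℝ) 1) : HasDerivAt (speed H) (H s / speed H s) s := by
  have hp := hH.speed_pos hs
  have hs' : s ∈ Set.Icc (0 : ℝ) 1 := ⟨hs.1.le, hs.2.le⟩
  rw [speed, clamp_of_mem hs'] at hp
  have h2 : 2 * pot H s ≠ 0 := (Real.sqrt_pos.1 hp).ne'
  have h1 : HasDerivAt (fun t => √(2 * pot H t)) (H s / speed H s) s := by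
    refine (((hasDerivAt_pot hH.cont s).const_mul 2).sqrt h2).congr_deriv ?_
    rw [speed, clamp_of_mem hs', mul_div_mul_left _ _ two_ne_zero]
  refine h1.congr_of_eventuallyEq ?_
  filter_upwards [Ioo_mem_nhds hs.1 hs.2] with t ht
  rw [speed, clamp_of_mem ⟨ht.1.le, ht.2.le⟩]

lemma NearForce.continuous_speed {H : ℝ → ℝ} (hH : NearForce H) : Continuous (speed H) := by
  have : Continuous (pot H) :=
    continuous_iff_continuousAt.2 fun y => (hasDerivAt_pot hH.cont y).continuousAt
  unfold speed
  exact ((this.comp continuous_clamp).const_mul 2).sqrt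

lemma speed_clamp (H : ℝ → ℝ) (s : ℝ) : speed H (clamp s) = speed H s := by
  rw [speed, clamp_of_mem (clamp_mem s), speed]

lemma NearForce.abs_speed_sub_le {H : ℝ → ℝ} (hH : NearForce H) (s t : ℝ) :
    |speed H s - speed H t| ≤ 10 * |s - t| := by
  have key : ∀ a b : ℝ, a ∈ Set.Icc (0 : ℝ) 1 → b ∈ Set.Icc (0 : ℝ) 1 → a < b →
      |speed H b - speed H a| ≤ 10 * |b - a| := by
    intro a b ha hb hab
    obtain ⟨c, hc, h⟩ := exists_hasDerivAt_eq_slope (speed H) (fun c => H c / speed H c) hab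
      hH.continuous_speed.continuousOn
      (fun x hx => hH.hasDerivAt_speed ⟨ha.1.trans_lt hx.1, hx.2.trans_le hb.2⟩)
    have hc' : c ∈ Set.Ioo (0 : ℝ) 1 := ⟨ha.1.trans_lt hc.1, hc.2.trans_le hb.2⟩
    have h1 : |H c / speed H c| ≤ 10 := by
      have hp := hH.speed_pos hc'
      rw [abs_div, abs_of_pos hp, div_le_iff₀ hp]
      have := hH.abs_le ⟨hc'.1.le, hc'.2.le⟩
      have := hH.le_speed ⟨hc'.1.le, hc'.2.le⟩
      linarith
    rw [h, abs_div] at h1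
    rwa [div_le_iff₀ (abs_pos.2 (sub_ne_zero.2 hab.ne'))] at h1
  have key2 : |speed H (clamp s) - speed H (clamp t)| ≤ 10 * |clamp s - clamp t| := by
    rcases lt_trichotomy (clamp s) (clamp t) with h | h | h
    · rw [abs_sub_comm, abs_sub_comm (clamp s)]
      exact key _ _ (clamp_mem s) (clamp_mem t) h
    · rw [h]; simp
    · exact key _ _ (clamp_mem t) (clamp_mem s) h
  rw [speed_clamp, speed_clamp] at key2
  exact key2.trans (mul_le_mul_of_nonneg_left (abs_clamp_sub_le s t) (by norm_num))

lemma speed_nonneg (H : ℝ → ℝ) (s : ℝ) : 0 ≤ speed H s := Real.sqrt_nonneg _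

lemma speed_zero (H : ℝ → ℝ) : speed H 0 = 0 := by
  rw [speed, clamp_of_mem (by simp), pot, intervalIntegral.integral_same]; simp

lemma NearForce.speed_one {H : ℝ → ℝ} (hH : NearForce H) : speed H 1 = 0 := by
  rw [speed, clamp_of_mem (by simp), pot, hH.mean]; simp

lemma NearForce.speed_le {H : ℝ → ℝ} (hH : NearForce H) (s : ℝ) : speed H s ≤ 10 := by
  have h1 := hH.abs_speed_sub_le (clamp s) 0
  rw [speed_zero, speed_clamp, sub_zero, sub_zero, abs_of_nonneg (speed_nonneg _ _),
    abs_of_nonneg (clamp_mem s).1] at h1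
  linarith [(clamp_mem s).2]

lemma NearForce.abs_speed_sub_speed_le {H K : ℝ → ℝ} (hH : NearForce H) (hK : NearForce K) {h : ℝ}
    (hHK : ∀ s ∈ Set.Icc (0 : ℝ) 1, |H s - K s| ≤ h) (s : ℝ) :
    |speed H s - speed K s| ≤ 4 * h := by
  have h0 : 0 ≤ h := (abs_nonneg _).trans (hHK 0 (by simp))
  rw [← speed_clamp H, ← speed_clamp K]
  have hs := clamp_mem s
  generalize clamp s = s at hs
  have e1 : |pot H s - pot K s| ≤ h * s := by
    rw [pot, pot, ← intervalIntegral.integral_sub (hH.cont.intervalIntegrable _ _)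
      (hK.cont.intervalIntegrable _ _)]
    have := intervalIntegral.norm_integral_le_of_norm_le_const (a := 0) (b := s) (C := h)
      (f := fun t => H t - K t) (fun t ht => by
        rw [Set.uIoc_of_le hs.1] at ht
        exact hHK t ⟨ht.1.le, ht.2.trans hs.2⟩)
    simpa [abs_of_nonneg hs.1] using this
  have e2 : |pot H s - pot K s| ≤ h * (1 - s) := by
    rw [hH.pot_eq_right, hK.pot_eq_right, neg_sub_neg, abs_sub_comm,
      ← intervalIntegral.integral_sub (hH.cont.intervalIntegrable _ _)
      (hK.cont.intervalIntegrable _ _)]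
    have := intervalIntegral.norm_integral_le_of_norm_le_const (a := s) (b := 1) (C := h)
      (f := fun t => H t - K t) (fun t ht => by
        rw [Set.uIoc_of_le hs.2] at ht
        exact hHK t ⟨hs.1.trans ht.1.le, ht.2⟩)
    simpa [abs_of_nonneg (sub_nonneg.2 hs.2)] using this
  rcases eq_or_lt_of_le hs.1 with h1 | h1
  · rw [← h1, speed_zero, speed_zero]; simp; positivity
  rcases eq_or_lt_of_le hs.2 with h2 | h2
  · rw [h2, hH.speed_one, hK.speed_one]; simp; positivity
  have p1 := hH.le_speed hs
  have p2 := hK.le_speed hs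
  have q0 : 0 < s * (1 - s) := mul_pos h1 (sub_pos.2 h2)
  have f : ∀ {L : ℝ → ℝ}, NearForce L → speed L s ^ 2 = 2 * pot L s := by
    intro L hL
    rw [speed, clamp_of_mem hs, Real.sq_sqrt]
    have := hL.le_pot hs
    nlinarith [sq_nonneg (s * (1 - s))]
  have e3 : |speed H s - speed K s| * (speed H s + speed K s) = 2 * |pot H s - pot K s| := by
    rw [← abs_of_nonneg (add_nonneg (speed_nonneg H s) (speed_nonneg K s)), ← abs_mul,
      show (speed H s - speed K s) * (speed H s + speed K s) = 2 * (pot H s - pot K s) by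
        linear_combination f hH - f hK, abs_mul, abs_two]
  have e4 : |pot H s - pot K s| ≤ 2 * h * (s * (1 - s)) := by
    rcases le_total s (1 / 2) with a | a <;>
      nlinarith [mul_nonneg h0 hs.1, mul_nonneg h0 (sub_nonneg.2 hs.2)]
  have e5 : |speed H s - speed K s| * (s * (1 - s)) ≤ 4 * h * (s * (1 - s)) := by
    calc _ ≤ |speed H s - speed K s| * (speed H s + speed K s) := by gcongr; linarith
      _ ≤ _ := by rw [e3]; linarith
  exact le_of_mul_le_mul_right e5 q0

/-- A continuous function close to a power on the unit interval. -/
structure NearPow (n : ℕ) (θ : ℝ → ℝ) : Prop where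
  cont : Continuous θ
  zero : θ 0 = 0
  lip : ∀ s ∈ Set.Icc (0 : ℝ) 1, ∀ t ∈ Set.Icc (0 : ℝ) 1,
    |(θ s - s ^ n) - (θ t - t ^ n)| ≤ 1 / 10 ^ 5 * |s - t|

/-- The mean over the unit interval. -/
noncomputable def mean (θ : ℝ → ℝ) : ℝ := ∫ s in (0 : ℝ)..1, θ s

/-- The determinant of the system determining the coefficients of the nonlinearity. -/
noncomputable def coefDet (θ η : ℝ → ℝ) : ℝ := mean θ * η 1 - mean η * θ 1

/-- The coefficient of the cubic term. -/
noncomputable def coefThree (θ η : ℝ → ℝ) : ℝ := (η 1 / 2 - mean η) / coefDet θ η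

/-- The coefficient of the quintic term. -/
noncomputable def coefFive (θ η : ℝ → ℝ) : ℝ := (θ 1 / 2 - mean θ) / coefDet θ η

/-- The effective force. -/
noncomputable def force (θ η : ℝ → ℝ) (s : ℝ) : ℝ :=
  clamp s - coefThree θ η * θ s + coefFive θ η * η s

namespace NearPow

variable {n : ℕ} {θ : ℝ → ℝ}

lemma abs_sub_le (h : NearPow n θ) (hn : n ≠ 0) {s : ℝ} (hs : s ∈ Set.Icc (0 : ℝ) 1) :
    |θ s - s ^ n| ≤ 1 / 10 ^ 5 * s := by
  have := h.lip s hs 0 (by simp)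
  rw [h.zero, zero_pow hn, sub_zero, sub_zero, sub_zero, abs_of_nonneg hs.1] at this
  exact this

lemma abs_le (h : NearPow n θ) (hn : n ≠ 0) {s : ℝ} (hs : s ∈ Set.Icc (0 : ℝ) 1) :
    |θ s| ≤ 11 / 10 := by
  have h1 := h.abs_sub_le hn hs
  have h2 : |s ^ n| ≤ 1 := by
    rw [abs_of_nonneg (pow_nonneg hs.1 n)]; exact pow_le_one₀ hs.1 hs.2
  have := abs_add_le (θ s - s ^ n) (s ^ n)
  rw [sub_add_cancel] at this
  linarith [hs.2]

lemma abs_one_sub_le (h : NearPow n θ) (hn : n ≠ 0) : |θ 1 - 1| ≤ 1 / 10 ^ 5 := by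
  simpa using h.abs_sub_le hn (s := 1) (by simp)

lemma abs_mean_sub_le (h : NearPow n θ) (hn : n ≠ 0) : |mean θ - 1 / (n + 1)| ≤ 1 / 10 ^ 5 := by
  have h1 : ∫ s in (0 : ℝ)..1, s ^ n = 1 / (n + 1) := by simp
  rw [← h1, mean, ← intervalIntegral.integral_sub (h.cont.intervalIntegrable _ _)
    ((continuous_pow n).intervalIntegrable _ _)]
  have := intervalIntegral.norm_integral_le_of_norm_le_const (a := 0) (b := 1) (C := 1 / 10 ^ 5)
    (f := fun t => θ t - t ^ n) (fun t ht => by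
      rw [Set.uIoc_of_le zero_le_one] at ht
      refine (h.abs_sub_le hn ⟨ht.1.le, ht.2⟩).trans ?_
      linarith [ht.2])
  simpa using this

end NearPow

lemma abs_mean_sub_mean_le {θ θ' : ℝ → ℝ} (h : Continuous θ) (h' : Continuous θ') {d : ℝ}
    (hd : ∀ s ∈ Set.Icc (0 : ℝ) 1, |θ s - θ' s| ≤ d) : |mean θ - mean θ'| ≤ d := by
  rw [mean, mean, ← intervalIntegral.integral_sub (h.intervalIntegrable _ _)
    (h'.intervalIntegrable _ _)]
  have := intervalIntegral.norm_integral_le_of_norm_le_const (a := 0) (b := 1) (C := d)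
    (f := fun t => θ t - θ' t) (fun t ht => by
      rw [Set.uIoc_of_le zero_le_one] at ht
      exact hd t ⟨ht.1.le, ht.2⟩)
  simpa using this

lemma abs_mul_sub_mul_le {a b a' b' A B d : ℝ} (hb : |b| ≤ B) (ha : |a'| ≤ A)
    (h1 : |a - a'| ≤ d) (h2 : |b - b'| ≤ d) : |a * b - a' * b'| ≤ (A + B) * d := by
  have h0 : 0 ≤ d := (abs_nonneg _).trans h1
  calc |a * b - a' * b'| = |(a - a') * b + a' * (b - b')| := by ring_nf
    _ ≤ |(a - a') * b| + |a' * (b - b')| := abs_add_le _ _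
    _ = |a - a'| * |b| + |a'| * |b - b'| := by rw [abs_mul, abs_mul]
    _ ≤ d * B + A * d := by gcongr; exact (abs_nonneg _).trans ha
    _ = _ := by ring

section Pair

variable {θ η : ℝ → ℝ} (h3 : NearPow 3 θ) (h5 : NearPow 5 η)
include h3 h5

lemma abs_coefDet_sub_le : |coefDet θ η - 1 / 12| ≤ 3 / 10 ^ 5 := by
  have m3 := h3.abs_mean_sub_le (by norm_num)
  have m5 := h5.abs_mean_sub_le (by norm_num)
  have e3 := h3.abs_one_sub_le (by norm_num)
  have e5 := h5.abs_one_sub_le (by norm_num)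
  norm_num at m3 m5
  have a3 := h3.abs_le (by norm_num) (s := 1) (by simp)
  have a5 := h5.abs_le (by norm_num) (s := 1) (by simp)
  have i1 := abs_mul_sub_mul_le (a := mean θ) (a' := 1 / 4) (A := 1 / 4) a5 (by norm_num)
    (by norm_num; exact m3) e5
  have i2 := abs_mul_sub_mul_le (a := mean η) (a' := 1 / 6) (A := 1 / 6) a3 (by norm_num)
    (by norm_num; exact m5) e3
  rw [coefDet]
  rw [abs_le] at *
  constructor <;> linarith [i1.1, i1.2, i2.1, i2.2]

lemma coefDet_ge : 1 / 13 ≤ coefDet θ η := by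
  have := (abs_le.1 (abs_coefDet_sub_le h3 h5)).1
  linarith

lemma abs_coefThree_sub_le : |coefThree θ η - 4| ≤ 2 / 10 ^ 3 := by
  have hd := coefDet_ge h3 h5
  have d := abs_coefDet_sub_le h3 h5
  have m5 := h5.abs_mean_sub_le (by norm_num)
  have e5 := h5.abs_one_sub_le (by norm_num)
  norm_num at m5
  have : coefThree θ η - 4 = (η 1 / 2 - mean η - 4 * coefDet θ η) / coefDet θ η := by
    rw [coefThree]; field_simp
  rw [this, abs_div, abs_of_pos (by linarith : 0 < coefDet θ η), div_le_iff₀ (by linarith)]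
  rw [abs_le] at *
  constructor <;> linarith [d.1, d.2]

lemma abs_coefFive_sub_le : |coefFive θ η - 3| ≤ 2 / 10 ^ 3 := by
  have hd := coefDet_ge h3 h5
  have d := abs_coefDet_sub_le h3 h5
  have m3 := h3.abs_mean_sub_le (by norm_num)
  have e3 := h3.abs_one_sub_le (by norm_num)
  norm_num at m3
  have : coefFive θ η - 3 = (θ 1 / 2 - mean θ - 3 * coefDet θ η) / coefDet θ η := by
    rw [coefFive]; field_simp
  rw [this, abs_div, abs_of_pos (by linarith : 0 < coefDet θ η), div_le_iff₀ (by linarith)]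
  rw [abs_le] at *
  constructor <;> linarith [d.1, d.2]

lemma abs_coefThree_le : |coefThree θ η| ≤ 5 := by
  have := abs_le.1 (abs_coefThree_sub_le h3 h5)
  rw [abs_le]; constructor <;> linarith [this.1, this.2]

lemma abs_coefFive_le : |coefFive θ η| ≤ 4 := by
  have := abs_le.1 (abs_coefFive_sub_le h3 h5)
  rw [abs_le]; constructor <;> linarith [this.1, this.2]

lemma force_one : force θ η 1 = 0 := by
  have hd := coefDet_ge h3 h5
  have hd' : coefDet θ η ≠ 0 := by linarith
  rw [force, clamp_of_mem (by simp), coefThree, coefFive]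
  field_simp
  rw [coefDet]
  ring

lemma force_zero : force θ η 0 = 0 := by
  rw [force, clamp_of_mem (by simp), h3.zero, h5.zero]; simp

lemma continuous_force : Continuous (force θ η) := by
  have := h3.cont
  have := h5.cont
  have := continuous_clamp
  unfold force
  fun_prop

lemma mean_force : mean (force θ η) = 0 := by
  have hd := coefDet_ge h3 h5
  have hd' : coefDet θ η ≠ 0 := by linarith
  have e : mean (force θ η) = 1 / 2 - coefThree θ η * mean θ + coefFive θ η * mean η := by
    have : mean (force θ η) = ∫ s in (0 : ℝ)..1,
        (s - coefThree θ η * θ s + coefFive θ η * η s) := by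
      refine intervalIntegral.integral_congr fun s hs => ?_
      rw [Set.uIcc_of_le zero_le_one] at hs
      simp only [force, clamp_of_mem hs]
    have c3 := h3.cont
    have c5 := h5.cont
    rw [this, intervalIntegral.integral_add (by apply Continuous.intervalIntegrable; fun_prop)
      (by apply Continuous.intervalIntegrable; fun_prop),
      intervalIntegral.integral_sub (by apply Continuous.intervalIntegrable; fun_prop)
      (by apply Continuous.intervalIntegrable; fun_prop),
      intervalIntegral.integral_const_mul, intervalIntegral.integral_const_mul, integral_id,
      mean, mean]
    norm_num
  rw [e, coefThree, coefFive]
  field_simp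
  rw [coefDet]
  ring

lemma force_sub_lip {s t : ℝ} (hs : s ∈ Set.Icc (0 : ℝ) 1) (ht : t ∈ Set.Icc (0 : ℝ) 1) :
    |(force θ η s - refForce s) - (force θ η t - refForce t)| ≤ 1 / 50 * |s - t| := by
  have b := abs_coefThree_sub_le h3 h5
  have g := abs_coefFive_sub_le h3 h5
  have b' := abs_coefThree_le h3 h5
  have g' := abs_coefFive_le h3 h5
  have l3 := h3.lip s hs t ht
  have l5 := h5.lip s hs t ht
  have key : ∀ n : ℕ, |s ^ n - t ^ n| ≤ n * |s - t| := by
    intro n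
    have := abs_pow_sub_pow_le s t n
    refine this.trans ?_
    have : max |s| |t| ^ (n - 1) ≤ 1 := by
      refine pow_le_one₀ (by positivity) (max_le ?_ ?_)
      · rw [abs_of_nonneg hs.1]; exact hs.2
      · rw [abs_of_nonneg ht.1]; exact ht.2
    calc _ ≤ |s - t| * n * 1 := by gcongr
      _ = _ := by ring
  have k3 := key 3
  have k5 := key 5
  push_cast at k3 k5
  set β := coefThree θ η
  set γ := coefFive θ η
  have e : (force θ η s - refForce s) - (force θ η t - refForce t) =
      -β * ((θ s - s ^ 3) - (θ t - t ^ 3)) + γ * ((η s - s ^ 5) - (η t - t ^ 5)) +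
      (-(β - 4) * (s ^ 3 - t ^ 3) + (γ - 3) * (s ^ 5 - t ^ 5)) := by
    simp only [force, refForce, clamp_of_mem hs, clamp_of_mem ht]
    ring
  rw [e]
  calc _ ≤ (|β| * (1 / 10 ^ 5 * |s - t|) + |γ| * (1 / 10 ^ 5 * |s - t|)) +
        (|β - 4| * (3 * |s - t|) + |γ - 3| * (5 * |s - t|)) := by
        refine (abs_add_le _ _).trans (add_le_add ((abs_add_le _ _).trans (add_le_add ?_ ?_))
          ((abs_add_le _ _).trans (add_le_add ?_ ?_)))
        · rw [abs_mul, abs_neg]; gcongr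
        · rw [abs_mul]; gcongr
        · rw [abs_mul, abs_neg]; gcongr
        · rw [abs_mul]; gcongr
    _ ≤ (5 * (1 / 10 ^ 5 * |s - t|) + 4 * (1 / 10 ^ 5 * |s - t|)) +
        (2 / 10 ^ 3 * (3 * |s - t|) + 2 / 10 ^ 3 * (5 * |s - t|)) := by gcongr
    _ ≤ _ := by nlinarith [abs_nonneg (s - t)]

lemma nearForce_force : NearForce (force θ η) where
  cont := continuous_force h3 h5
  left s hs := by
    have := force_sub_lip h3 h5 hs (t := 0) (by simp)
    rw [force_zero h3 h5] at this
    simpa [refForce, abs_of_nonneg hs.1] using this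
  right s hs := by
    have := force_sub_lip h3 h5 hs (t := 1) (by simp)
    rw [force_one h3 h5, show refForce 1 = 0 by norm_num [refForce], sub_zero, sub_zero,
      abs_sub_comm s, abs_of_nonneg (sub_nonneg.2 hs.2)] at this
    exact this
  mean := mean_force h3 h5

variable {θ' η' : ℝ → ℝ} (h3' : NearPow 3 θ') (h5' : NearPow 5 η') {d : ℝ}
  (hθ : ∀ s ∈ Set.Icc (0 : ℝ) 1, |θ s - θ' s| ≤ d) (hη : ∀ s ∈ Set.Icc (0 : ℝ) 1, |η s - η' s| ≤ d)
include h3' h5' hθ hη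

lemma abs_coefDet_sub_coefDet_le : |coefDet θ η - coefDet θ' η'| ≤ 3 * d := by
  have m3 := abs_mean_sub_mean_le h3.cont h3'.cont hθ
  have m5 := abs_mean_sub_mean_le h5.cont h5'.cont hη
  have n3 := hθ 1 (by simp)
  have n5 := hη 1 (by simp)
  have a3 := h3.abs_le (by norm_num) (s := 1) (by simp)
  have a5 := h5.abs_le (by norm_num) (s := 1) (by simp)
  have p3 := h3'.abs_mean_sub_le (by norm_num)
  have p5 := h5'.abs_mean_sub_le (by norm_num)
  norm_num at p3 p5
  have q3 : |mean θ'| ≤ 3 / 10 := by rw [abs_le] at *; constructor <;> linarith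
  have q5 : |mean η'| ≤ 3 / 10 := by rw [abs_le] at *; constructor <;> linarith
  have i1 := abs_mul_sub_mul_le a5 q3 m3 n5
  have i2 := abs_mul_sub_mul_le a3 q5 m5 n3
  have d0 : 0 ≤ d := (abs_nonneg _).trans n3
  rw [coefDet, coefDet]
  rw [abs_le] at *
  constructor <;> linarith [i1.1, i1.2, i2.1, i2.2]

lemma abs_coefThree_sub_coefThree_le : |coefThree θ η - coefThree θ' η'| ≤ 300 * d := by
  have dd := abs_coefDet_sub_coefDet_le h3 h5 h3' h5' hθ hη
  have hd := coefDet_ge h3 h5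
  have hd' := coefDet_ge h3' h5'
  have c := abs_coefThree_le h3' h5'
  have m5 := abs_mean_sub_mean_le h5.cont h5'.cont hη
  have n5 := hη 1 (by simp)
  have e' : coefThree θ' η' * coefDet θ' η' = η' 1 / 2 - mean η' := by
    rw [coefThree]; field_simp
  have e : coefThree θ η - coefThree θ' η' = ((η 1 - η' 1) / 2 - (mean η - mean η') -
      coefThree θ' η' * (coefDet θ η - coefDet θ' η')) / coefDet θ η := by
    rw [mul_sub, e']
    nth_rewrite 1 [coefThree]
    field_simp
    ring
  have d0 : 0 ≤ d := (abs_nonneg _).trans n5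
  rw [e, abs_div, abs_of_pos (by linarith : 0 < coefDet θ η), div_le_iff₀ (by linarith)]
  have i : |coefThree θ' η' * (coefDet θ η - coefDet θ' η')| ≤ 5 * (3 * d) := by
    rw [abs_mul]; gcongr
  have j : 300 * d * (1 / 13) ≤ 300 * d * coefDet θ η := by gcongr
  rw [abs_le] at *
  constructor <;> linarith [i.1, i.2]

lemma abs_coefFive_sub_coefFive_le : |coefFive θ η - coefFive θ' η'| ≤ 300 * d := by
  have dd := abs_coefDet_sub_coefDet_le h3 h5 h3' h5' hθ hη
  have hd := coefDet_ge h3 h5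
  have hd' := coefDet_ge h3' h5'
  have c := abs_coefFive_le h3' h5'
  have m3 := abs_mean_sub_mean_le h3.cont h3'.cont hθ
  have n3 := hθ 1 (by simp)
  have e' : coefFive θ' η' * coefDet θ' η' = θ' 1 / 2 - mean θ' := by
    rw [coefFive]; field_simp
  have e : coefFive θ η - coefFive θ' η' = ((θ 1 - θ' 1) / 2 - (mean θ - mean θ') -
      coefFive θ' η' * (coefDet θ η - coefDet θ' η')) / coefDet θ η := by
    rw [mul_sub, e']
    nth_rewrite 1 [coefFive]
    field_simp
    ring
  have d0 : 0 ≤ d := (abs_nonneg _).trans n3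
  rw [e, abs_div, abs_of_pos (by linarith : 0 < coefDet θ η), div_le_iff₀ (by linarith)]
  have i : |coefFive θ' η' * (coefDet θ η - coefDet θ' η')| ≤ 4 * (3 * d) := by
    rw [abs_mul]; gcongr
  have j : 300 * d * (1 / 13) ≤ 300 * d * coefDet θ η := by gcongr
  rw [abs_le] at *
  constructor <;> linarith [i.1, i.2]

lemma abs_force_sub_force_le {s : ℝ} (hs : s ∈ Set.Icc (0 : ℝ) 1) :
    |force θ η s - force θ' η' s| ≤ 1000 * d := by
  have d0 : 0 ≤ d := (abs_nonneg _).trans (hθ s hs)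
  have c3 := abs_coefThree_sub_coefThree_le h3 h5 h3' h5' hθ hη
  have c5 := abs_coefFive_sub_coefFive_le h3 h5 h3' h5' hθ hη
  have b3 := abs_coefThree_le h3' h5'
  have b5 := abs_coefFive_le h3' h5'
  have a3 := h3.abs_le (by norm_num) hs
  have a5 := h5.abs_le (by norm_num) hs
  have e : force θ η s - force θ' η' s =
      (-(coefThree θ η - coefThree θ' η') * θ s + -coefThree θ' η' * (θ s - θ' s)) +
      ((coefFive θ η - coefFive θ' η') * η s + coefFive θ' η' * (η s - η' s)) := by
    rw [force, force]; ring
  rw [e]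
  calc _ ≤ (300 * d * (11 / 10) + 5 * d) + (300 * d * (11 / 10) + 4 * d) := by
        refine (abs_add_le _ _).trans (add_le_add ((abs_add_le _ _).trans (add_le_add ?_ ?_))
          ((abs_add_le _ _).trans (add_le_add ?_ ?_)))
        · rw [abs_mul, abs_neg]; gcongr
        · rw [abs_mul, abs_neg]; gcongr; exact hθ s hs
        · rw [abs_mul]; gcongr
        · rw [abs_mul]; gcongr; exact hη s hs
    _ ≤ _ := by linarith

end Pair

lemma exists_flow {P : ℝ → ℝ} {K L : ℝ≥0} (hP : LipschitzWith K P) (hL : ∀ s, |P s| ≤ L)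
    (x : ℝ) : ∃ α : ℝ → ℝ, α 0 = x ∧ ∀ t, HasDerivAt α (P (α t)) t := by
  have h1 : ∀ n : ℕ, ∃ α : ℝ → ℝ, α 0 = x ∧
      ∀ t ∈ Set.Ioo (-(n + 1 : ℝ)) (n + 1), HasDerivAt α (P (α t)) t := by
    intro n
    have h0 : (0 : ℝ) ∈ Set.Icc (-(n + 1 : ℝ)) (n + 1) := ⟨by linarith, by positivity⟩
    have hp : IsPicardLindelof (fun _ => P) (⟨0, h0⟩ : Set.Icc (-(n + 1 : ℝ)) (n + 1)) x
        (L * (n + 1)) 0 L K :=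
      { lipschitzOnWith := fun t _ => hP.lipschitzOnWith
        continuousOn := fun y _ => continuousOn_const
        norm_le := fun t _ y _ => hL y
        mul_max_le := by simp }
    obtain ⟨α, ha, hd⟩ := hp.exists_eq_forall_mem_Icc_hasDerivWithinAt₀
    exact ⟨α, ha, fun t ht => (hd t ⟨ht.1.le, ht.2.le⟩).hasDerivAt (Icc_mem_nhds ht.1 ht.2)⟩
  choose α ha hd using h1
  have agree : ∀ (m n : ℕ) (t : ℝ), |t| < m + 1 → |t| < n + 1 → α m t = α n t := by
    intro m n t hm hn
    rw [abs_lt] at hm hn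
    rcases le_total m n with h | h
    · have h' : (m : ℝ) ≤ n := by exact_mod_cast h
      exact ODE_solution_unique_of_mem_Ioo (v := fun _ => P) (s := fun _ => Set.univ) (K := K)
        (fun t _ => hP.lipschitzOnWith) (t₀ := 0) (a := -(m + 1 : ℝ)) (b := m + 1)
        ⟨by linarith, by positivity⟩ (fun t ht => ⟨hd m t ht, trivial⟩)
        (fun t ht => ⟨hd n t ⟨by linarith [ht.1], by linarith [ht.2]⟩, trivial⟩)
        (by rw [ha, ha]) hm
    · have h' : (n : ℝ) ≤ m := by exact_mod_cast h
      exact ODE_solution_unique_of_mem_Ioo (v := fun _ => P) (s := fun _ => Set.univ) (K := K)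
        (fun t _ => hP.lipschitzOnWith) (t₀ := 0) (a := -(n + 1 : ℝ)) (b := n + 1)
        ⟨by linarith, by positivity⟩
        (fun t ht => ⟨hd m t ⟨by linarith [ht.1], by linarith [ht.2]⟩, trivial⟩)
        (fun t ht => ⟨hd n t ht, trivial⟩) (by rw [ha, ha]) hn
  have lt_ceil : ∀ t : ℝ, |t| < (⌈|t|⌉₊ : ℝ) + 1 := fun t =>
    (Nat.le_ceil _).trans_lt (lt_add_one _)
  refine ⟨fun t => α ⌈|t|⌉₊ t, by simp [ha], fun t => ?_⟩
  refine (hd ⌈|t|⌉₊ t (abs_lt.1 (lt_ceil t))).congr_of_eventuallyEq ?_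
  have : Set.Ioo (-((⌈|t|⌉₊ : ℝ) + 1)) (⌈|t|⌉₊ + 1) ∈ 𝓝 t :=
    Ioo_mem_nhds (abs_lt.1 (lt_ceil t)).1 (abs_lt.1 (lt_ceil t)).2
  filter_upwards [this] with s hs
  exact agree _ _ _ (lt_ceil s) (abs_lt.2 hs)

open Classical in
/-- The flow of an autonomous scalar field. -/
noncomputable def flow (P : ℝ → ℝ) (t x : ℝ) : ℝ :=
  if h : ∃ α : ℝ → ℝ, α 0 = x ∧ ∀ t, HasDerivAt α (P (α t)) t then h.choose t else x

section Flow

variable {P : ℝ → ℝ} {K L : ℝ≥0} (hP : LipschitzWith K P) (hL : ∀ s, |P s| ≤ L)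
include hP hL

lemma flow_spec (x : ℝ) :
    flow P 0 x = x ∧ ∀ t, HasDerivAt (fun t => flow P t x) (P (flow P t x)) t := by
  have h := exists_flow hP hL x
  have e : (fun t => flow P t x) = h.choose := by funext t; rw [flow, dif_pos h]
  refine ⟨?_, fun t => ?_⟩
  · exact (congrFun e 0).trans h.choose_spec.1
  · have := h.choose_spec.2 t
    rw [← e] at this
    exact this

lemma flow_eq {x : ℝ} {α : ℝ → ℝ} {t₀ : ℝ} (ha : α t₀ = flow P t₀ x)
    (hd : ∀ t, HasDerivAt α (P (α t)) t) (t : ℝ) : flow P t x = α t :=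
  congrFun (ODE_solution_unique_univ (v := fun _ => P) (s := fun _ => Set.univ) (K := K)
    (t₀ := t₀) (f := fun t => flow P t x) (g := α) (fun _ => hP.lipschitzOnWith)
    (fun t => ⟨(flow_spec hP hL x).2 t, trivial⟩) (fun t => ⟨hd t, trivial⟩) ha.symm) t

lemma flow_flow (t t' x : ℝ) : flow P t (flow P t' x) = flow P (t + t') x := by
  refine flow_eq hP hL (t₀ := 0) (α := fun t => flow P (t + t') x) ?_ (fun t => ?_) t
  · rw [(flow_spec hP hL _).1, zero_add]
  · exact ((flow_spec hP hL x).2 (t + t')).comp_add_const t t'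

lemma flow_of_zero {x : ℝ} (hx : P x = 0) (t : ℝ) : flow P t x = x :=
  flow_eq hP hL (t₀ := 0) (α := fun _ => x) (flow_spec hP hL x).1.symm
    (fun t => by rw [hx]; exact hasDerivAt_const t x) t

lemma flow_ne {x c : ℝ} (hc : P c = 0) (hx : x ≠ c) (t : ℝ) : flow P t x ≠ c := by
  intro h
  have := flow_eq hP hL (x := x) (t₀ := t) (α := fun _ => c) h.symm
    (fun t => by rw [hc]; exact hasDerivAt_const t c) 0
  rw [(flow_spec hP hL x).1] at this
  exact hx this

lemma continuous_flow (x : ℝ) : Continuous fun t => flow P t x :=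
  continuous_iff_continuousAt.2 fun t => ((flow_spec hP hL x).2 t).continuousAt

lemma flow_mem_Ioo {x a b : ℝ} (ha : P a = 0) (hb : P b = 0) (hx : x ∈ Set.Ioo a b) (t : ℝ) :
    flow P t x ∈ Set.Ioo a b := by
  have hc := continuous_flow hP hL x
  have h0 := (flow_spec hP hL x).1
  constructor
  · by_contra! h
    obtain ⟨s, hs⟩ := mem_range_of_exists_le_of_exists_ge hc ⟨t, h⟩ ⟨0, by rw [h0]; exact hx.1.le⟩
    exact flow_ne hP hL ha hx.1.ne' s hs
  · by_contra! h
    obtain ⟨s, hs⟩ := mem_range_of_exists_le_of_exists_ge hc ⟨0, by rw [h0]; exact hx.2.le⟩ ⟨t, h⟩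
    exact flow_ne hP hL hb hx.2.ne s hs

end Flow

lemma abs_sub_le_of_approx_right {P : ℝ → ℝ} {K : ℝ≥0} (hK : 1 ≤ K) (hP : LipschitzWith K P)
    {α β β' : ℝ → ℝ} {d : ℝ} (ha : ∀ t, HasDerivAt α (P (α t)) t)
    (hb : ∀ t, HasDerivAt β (β' t) t) (hd : ∀ t, |β' t - P (β t)| ≤ d) {t : ℝ} (ht : 0 ≤ t) :
    |α t - β t| ≤ (|α 0 - β 0| + d) * exp (K * t) := by
  have h := dist_le_of_approx_trajectories_ODE (v := fun _ => P) (K := K) (a := 0) (b := t)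
    (f := α) (g := β) (f' := fun t => P (α t)) (g' := β') (εf := 0) (εg := d)
    (δ := |α 0 - β 0|) (fun _ => hP)
    (fun s _ => (ha s).continuousAt.continuousWithinAt) (fun s _ => (ha s).hasDerivWithinAt)
    (fun s _ => by simp)
    (fun s _ => (hb s).continuousAt.continuousWithinAt) (fun s _ => (hb s).hasDerivWithinAt)
    (fun s _ => hd s) le_rfl t ⟨ht, le_rfl⟩
  have hK' : (1 : ℝ) ≤ K := by exact_mod_cast hK
  have d0 : 0 ≤ d := (abs_nonneg _).trans (hd 0)
  rw [gronwallBound_of_K_ne_0 (by positivity), sub_zero, zero_add, Real.dist_eq] at h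
  refine h.trans ?_
  have e1 : d / K ≤ d := div_le_self d0 hK'
  have e2 : (1 : ℝ) ≤ exp (K * t) := Real.one_le_exp (by positivity)
  have e3 : d / K * (exp (K * t) - 1) ≤ d * exp (K * t) :=
    mul_le_mul e1 (by linarith) (by linarith) d0
  rw [add_mul]
  linarith

/-- Grönwall's inequality for approximate trajectories, in both time directions. -/
lemma abs_sub_le_of_approx {P : ℝ → ℝ} {K : ℝ≥0} (hK : 1 ≤ K) (hP : LipschitzWith K P)
    {α β β' : ℝ → ℝ} {d : ℝ} (ha : ∀ t, HasDerivAt α (P (α t)) t)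
    (hb : ∀ t, HasDerivAt β (β' t) t) (hd : ∀ t, |β' t - P (β t)| ≤ d) (t : ℝ) :
    |α t - β t| ≤ (|α 0 - β 0| + d) * exp (K * |t|) := by
  rcases le_total 0 t with ht | ht
  · rw [abs_of_nonneg ht]
    exact abs_sub_le_of_approx_right hK hP ha hb hd ht
  · have hn : LipschitzWith K (fun s => -P s) := hP.neg
    have r : ∀ {f : ℝ → ℝ} {f' : ℝ → ℝ}, (∀ t, HasDerivAt f (f' t) t) →
        ∀ t, HasDerivAt (fun t => f (-t)) (-f' (-t)) t := by
      intro f f' hf t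
      exact ((hf (-t)).scomp t (hasDerivAt_neg t)).congr_deriv (by simp)
    have := abs_sub_le_of_approx_right hK hn (r ha) (r hb) (d := d) (fun t => by
      rw [neg_sub_neg, abs_sub_comm]; exact hd (-t)) (neg_nonneg.2 ht)
    simpa [abs_of_nonpos ht] using this

lemma abs_flow_sub_flow_le {P Q : ℝ → ℝ} {K L : ℝ≥0} (hK : 1 ≤ K) (hP : LipschitzWith K P)
    (hL : ∀ s, |P s| ≤ L) (hQ : LipschitzWith K Q) (hL' : ∀ s, |Q s| ≤ L) {d : ℝ}
    (hd : ∀ s, |P s - Q s| ≤ d) (t x y : ℝ) :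
    |flow P t x - flow Q t y| ≤ (|x - y| + d) * exp (K * |t|) := by
  have := abs_sub_le_of_approx hK hP (flow_spec hP hL x).2 (flow_spec hQ hL' y).2 (d := d)
    (fun t => by rw [abs_sub_comm]; exact hd _) t
  rwa [(flow_spec hP hL x).1, (flow_spec hQ hL' y).1] at this

/-- Maps into `ℓ¹(ℤ)` that are bounded and Lipschitz with the same constant. -/
structure LipBound (c : ℝ) (p : ℝ → SeqSp) : Prop where
  bound : ∀ s, ‖p s‖ ≤ c
  lip : ∀ s t, ‖p s - p t‖ ≤ c * |s - t|

lemma norm_conv_sub_conv_le {r : ℝ} (hr : 1 ≤ r) (a b a' b' : SeqSp) :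
    ‖conv r a b - conv r a' b'‖ ≤ ‖a - a'‖ * ‖b‖ + ‖a'‖ * ‖b - b'‖ := by
  have : conv r a b - conv r a' b' = conv r (a - a') b + conv r a' (b - b') := by
    simp only [map_sub, sub_apply]; abel
  rw [this]
  exact (norm_add_le _ _).trans (add_le_add (norm_conv_le hr _ _) (norm_conv_le hr _ _))

namespace LipBound

variable {c c' : ℝ} {p q : ℝ → SeqSp}

lemma nonneg (h : LipBound c p) : 0 ≤ c := (norm_nonneg _).trans (h.bound 0)

lemma mono (h : LipBound c p) (hc : c ≤ c') : LipBound c' p where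
  bound s := (h.bound s).trans hc
  lip s t := (h.lip s t).trans (by gcongr)

lemma add (h : LipBound c p) (h' : LipBound c' q) : LipBound (c + c') fun s => p s + q s where
  bound s := (norm_add_le _ _).trans (add_le_add (h.bound s) (h'.bound s))
  lip s t := by
    rw [add_sub_add_comm, add_mul]
    exact (norm_add_le _ _).trans (add_le_add (h.lip s t) (h'.lip s t))

lemma smul (h : LipBound c p) (k : ℝ) : LipBound (|k| * c) fun s => k • p s where
  bound s := by
    rw [norm_smul, Real.norm_eq_abs]; exact mul_le_mul_of_nonneg_left (h.bound s) (abs_nonneg k)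
  lip s t := by
    rw [← smul_sub, norm_smul, Real.norm_eq_abs, mul_assoc]
    exact mul_le_mul_of_nonneg_left (h.lip s t) (abs_nonneg k)

lemma conv (h : LipBound c p) (h' : LipBound c' q) :
    LipBound (2 * c * c') fun s => StripSolution.conv 2 (p s) (q s) where
  bound s := by
    have h0 := h.nonneg
    have h0' := h'.nonneg
    refine (norm_conv_le one_le_two _ _).trans
      ((mul_le_mul (h.bound s) (h'.bound s) (norm_nonneg _) h0).trans ?_)
    nlinarith [mul_nonneg h0 h0']
  lip s t := by
    have h0 := h.nonneg
    have h0' := h'.nonneg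
    refine (norm_conv_sub_conv_le one_le_two _ _ _ _).trans ?_
    have e1 := mul_le_mul (h.lip s t) (h'.bound s) (norm_nonneg _) (by positivity)
    have e2 := mul_le_mul (h.bound t) (h'.lip s t) (norm_nonneg _) h0
    linarith

lemma continuous (h : LipBound c p) : Continuous p :=
  (LipschitzWith.of_dist_le_mul (K := ⟨c, h.nonneg⟩) fun s t => by
    rw [dist_eq_norm, Real.dist_eq]; exact h.lip s t).continuous

end LipBound

/-- The exponential with frequency `k`. -/
noncomputable def expVec (k : ℤ) : SeqSp := (2 : ℝ) ^ k.natAbs • unitVec k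

lemma conv_expVec (j k : ℤ) : conv 2 (expVec j) (expVec k) = expVec (j + k) := by
  simp only [expVec, map_smul, smul_apply, conv_unitVec one_le_two, smul_smul, cw]
  congr 1
  field_simp

/-- The sequence of the function `sin`. -/
noncomputable def sinVec : SeqSp := expVec 1 - expVec (-1)

lemma norm_sinVec_le : ‖sinVec‖ ≤ 4 := by
  refine (norm_sub_le _ _).trans ?_
  simp only [expVec, norm_smul, norm_unitVec]
  norm_num

lemma refl_sinVec : refl sinVec = -sinVec := by
  simp [sinVec, expVec, refl_unitVec]

lemma conv_sinVec_sinVec : conv 2 sinVec sinVec = expVec 2 - (2 : ℝ) • expVec 0 + expVec (-2) := by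
  simp only [sinVec, map_sub, sub_apply, conv_expVec]
  norm_num
  module

lemma cube_sinVec : cube 2 sinVec =
    expVec 3 - (3 : ℝ) • expVec 1 + (3 : ℝ) • expVec (-1) - expVec (-3) := by
  rw [cube, conv_sinVec_sinVec]
  simp only [sinVec, map_sub, map_add, map_smul, sub_apply, conv_expVec]
  norm_num
  module

lemma quint_sinVec : quint 2 sinVec =
    expVec 5 - (5 : ℝ) • expVec 3 + (10 : ℝ) • expVec 1 - (10 : ℝ) • expVec (-1)
      + (5 : ℝ) • expVec (-3) - expVec (-5) := by
  rw [quint, cube_sinVec]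
  simp only [sinVec, map_sub, map_add, map_smul, sub_apply, conv_expVec]
  norm_num
  module

lemma coord_one_sinVec : coord 1 sinVec = 2 := by
  simp [sinVec, expVec, coord_unitVec]

lemma coord_one_cube_sinVec : coord 1 (cube 2 sinVec) = -6 := by
  simp [cube_sinVec, expVec, coord_unitVec]; norm_num

lemma coord_one_quint_sinVec : coord 1 (quint 2 sinVec) = 20 := by
  simp [quint_sinVec, expVec, coord_unitVec]; norm_num

lemma cube_smul (c : ℝ) (a : SeqSp) : cube 2 (c • a) = c ^ 3 • cube 2 a := by
  simp only [cube, map_smul, smul_apply, smul_smul]; congr 1; ring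

lemma quint_smul (c : ℝ) (a : SeqSp) : quint 2 (c • a) = c ^ 5 • quint 2 a := by
  simp only [quint, cube_smul, map_smul, smul_apply, smul_smul]; congr 1

/-- Admissible corrections to the leading mode. -/
structure Correction (v : ℝ → SeqSp) : Prop where
  lip : LipBound (4 / 10 ^ 9) v
  zero : v 0 = 0
  odd : ∀ s, refl (v s) = -v s

/-- The amplitude sequence with parameter `s`. -/
noncomputable def amp (v : ℝ → SeqSp) (s : ℝ) : SeqSp := clamp s • sinVec + v s

lemma lipBound_clamp : LipBound 4 fun s => clamp s • sinVec where
  bound s := by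
    rw [norm_smul, Real.norm_eq_abs, abs_of_nonneg (clamp_mem s).1]
    nlinarith [norm_sinVec_le, norm_nonneg sinVec, clamp_mem s |>.1, clamp_mem s |>.2]
  lip s t := by
    rw [← sub_smul, norm_smul, Real.norm_eq_abs, mul_comm]
    exact mul_le_mul norm_sinVec_le (abs_clamp_sub_le s t) (abs_nonneg _) (by norm_num)

namespace Correction

variable {v : ℝ → SeqSp} (hv : Correction v)
include hv

lemma lipBound_amp : LipBound 5 (amp v) :=
  (lipBound_clamp.add hv.lip).mono (by norm_num)

lemma refl_amp (s : ℝ) : refl (amp v s) = -amp v s := by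
  rw [amp, map_add, map_smul, refl_sinVec, hv.odd]; module

lemma lipBound_cube : LipBound 500 fun s => cube 2 (amp v s) :=
  (hv.lipBound_amp.conv (hv.lipBound_amp.conv hv.lipBound_amp)).mono (by norm_num)

lemma lipBound_quint : LipBound 50000 fun s => quint 2 (amp v s) :=
  (hv.lipBound_amp.conv (hv.lipBound_amp.conv hv.lipBound_cube)).mono (by norm_num)

lemma lipBound_conv_sub {c d : ℝ} {p q : ℝ → SeqSp} (hp : LipBound c p)
    (hd : LipBound d fun s => p s - q s) :
    LipBound (8 / 10 ^ 9 * c + 10 * d)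
      fun s => conv 2 (amp v s) (p s) - conv 2 (clamp s • sinVec) (q s) := by
  have h1 := (hv.lip.conv hp).add ((lipBound_clamp.mono (by norm_num : (4 : ℝ) ≤ 5)).conv hd)
  have e : (fun s => conv 2 (amp v s) (p s) - conv 2 (clamp s • sinVec) (q s)) =
      fun s => conv 2 (v s) (p s) + conv 2 (clamp s • sinVec) (p s - q s) := by
    funext s
    simp only [amp, map_sub, map_add, add_apply]
    abel
  rw [e]
  refine h1.mono (le_of_eq ?_)
  ring

lemma lipBound_sq_sub : LipBound (8 / 10 ^ 8) fun s =>
    conv 2 (amp v s) (amp v s) - conv 2 (clamp s • sinVec) (clamp s • sinVec) := by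
  refine (hv.lipBound_conv_sub (d := 4 / 10 ^ 9) hv.lipBound_amp ?_).mono (by norm_num)
  have : (fun s => amp v s - clamp s • sinVec) = v := by funext s; simp [amp]
  rw [this]; exact hv.lip

lemma lipBound_cube_sub : LipBound (12 / 10 ^ 7) fun s =>
    cube 2 (amp v s) - cube 2 (clamp s • sinVec) :=
  (hv.lipBound_conv_sub ((hv.lipBound_amp.conv hv.lipBound_amp).mono (by norm_num :
    (2 * 5 * 5 : ℝ) ≤ 50)) hv.lipBound_sq_sub).mono (by norm_num)

lemma lipBound_quint_sub : LipBound (2 / 10 ^ 4) fun s =>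
    quint 2 (amp v s) - quint 2 (clamp s • sinVec) :=
  (hv.lipBound_conv_sub ((hv.lipBound_amp.conv hv.lipBound_cube).mono (by norm_num :
    (2 * 5 * 500 : ℝ) ≤ 5000)) (hv.lipBound_conv_sub hv.lipBound_cube
      hv.lipBound_cube_sub)).mono (by norm_num)

end Correction

/-- The projection of the cubic term onto the leading mode. -/
noncomputable def cubicMoment (v : ℝ → SeqSp) (s : ℝ) : ℝ := -coord 1 (cube 2 (amp v s)) / 6

/-- The projection of the quintic term onto the leading mode. -/
noncomputable def quinticMoment (v : ℝ → SeqSp) (s : ℝ) : ℝ := coord 1 (quint 2 (amp v s)) / 20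

namespace Correction

variable {v : ℝ → SeqSp} (hv : Correction v)
include hv

lemma amp_zero : amp v 0 = 0 := by simp [amp, hv.zero, clamp]

lemma nearPow_cubicMoment : NearPow 3 (cubicMoment v) where
  cont := ((coord 1).continuous.comp hv.lipBound_cube.continuous).neg.div_const 6
  zero := by simp [cubicMoment, hv.amp_zero, cube]
  lip s hs t ht := by
    have e : ∀ s ∈ Set.Icc (0 : ℝ) 1, cubicMoment v s - s ^ 3 =
        -coord 1 (cube 2 (amp v s) - cube 2 (clamp s • sinVec)) / 6 := by
      intro s hs
      rw [map_sub, cube_smul, map_smul, coord_one_cube_sinVec, clamp_of_mem hs, cubicMoment,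
        smul_eq_mul]
      ring
    rw [e s hs, e t ht, ← sub_div, neg_sub_neg, ← map_sub, abs_div]
    have h1 := abs_coord_le 1 (cube 2 (amp v t) - cube 2 (clamp t • sinVec) -
      (cube 2 (amp v s) - cube 2 (clamp s • sinVec)))
    have h2 := hv.lipBound_cube_sub.lip t s
    rw [abs_sub_comm t s] at h2
    have h3 := abs_nonneg (s - t)
    rw [abs_of_pos (by norm_num : (0 : ℝ) < 6), div_le_iff₀ (by norm_num)]
    linarith

lemma nearPow_quinticMoment : NearPow 5 (quinticMoment v) where
  cont := ((coord 1).continuous.comp hv.lipBound_quint.continuous).div_const 20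
  zero := by simp [quinticMoment, hv.amp_zero, quint]
  lip s hs t ht := by
    have e : ∀ s ∈ Set.Icc (0 : ℝ) 1, quinticMoment v s - s ^ 5 =
        coord 1 (quint 2 (amp v s) - quint 2 (clamp s • sinVec)) / 20 := by
      intro s hs
      rw [map_sub, quint_smul, map_smul, coord_one_quint_sinVec, clamp_of_mem hs, quinticMoment,
        smul_eq_mul]
      ring
    rw [e s hs, e t ht, ← sub_div, ← map_sub, abs_div]
    have h1 := abs_coord_le 1 (quint 2 (amp v s) - quint 2 (clamp s • sinVec) -
      (quint 2 (amp v t) - quint 2 (clamp t • sinVec)))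
    have h2 := hv.lipBound_quint_sub.lip s t
    have h3 := abs_nonneg (s - t)
    rw [abs_of_pos (by norm_num : (0 : ℝ) < 20), div_le_iff₀ (by norm_num)]
    linarith

end Correction

/-- The coefficient of the cubic term selected by a correction. -/
noncomputable def cubicCoef (v : ℝ → SeqSp) : ℝ := coefThree (cubicMoment v) (quinticMoment v)

/-- The coefficient of the quintic term selected by a correction. -/
noncomputable def quinticCoef (v : ℝ → SeqSp) : ℝ := coefFive (cubicMoment v) (quinticMoment v)

/-- The force acting on the leading mode. -/
noncomputable def modeForce (v : ℝ → SeqSp) : ℝ → ℝ := force (cubicMoment v) (quinticMoment v)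

/-- The speed of the leading mode. -/
noncomputable def modeSpeed (v : ℝ → SeqSp) : ℝ → ℝ := speed (modeForce v)

/-- The sequence form of the perturbation of the nonlinearity. -/
noncomputable def nonlin (v : ℝ → SeqSp) (s : ℝ) : SeqSp :=
  (-1 : ℝ) • amp v s + (-(cubicCoef v / 3)) • cube 2 (amp v s)
    + (-(quinticCoef v / 10)) • quint 2 (amp v s)

lemma norm_smul_sub_smul_le (c c' : ℝ) (z z' : SeqSp) :
    ‖c • z - c' • z'‖ ≤ |c| * ‖z - z'‖ + |c - c'| * ‖z'‖ := by
  have : c • z - c' • z' = c • (z - z') + (c - c') • z' := by module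
  rw [this]
  refine (norm_add_le _ _).trans ?_
  rw [norm_smul, norm_smul, Real.norm_eq_abs, Real.norm_eq_abs]

namespace Correction

variable {v : ℝ → SeqSp} (hv : Correction v)
include hv

lemma nearForce : NearForce (modeForce v) :=
  nearForce_force hv.nearPow_cubicMoment hv.nearPow_quinticMoment

lemma abs_cubicCoef_le : |cubicCoef v| ≤ 5 :=
  abs_coefThree_le hv.nearPow_cubicMoment hv.nearPow_quinticMoment

lemma abs_quinticCoef_le : |quinticCoef v| ≤ 4 :=
  abs_coefFive_le hv.nearPow_cubicMoment hv.nearPow_quinticMoment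

lemma refl_nonlin (s : ℝ) : refl (nonlin v s) = -nonlin v s := by
  rw [nonlin, map_add, map_add, map_smul, map_smul, map_smul, hv.refl_amp,
    refl_cube one_le_two (hv.refl_amp s), refl_quint one_le_two (hv.refl_amp s)]
  module

lemma nonlin_zero : nonlin v 0 = 0 := by simp [nonlin, hv.amp_zero, cube, quint]

lemma lipBound_nonlin : LipBound 21000 (nonlin v) := by
  have h3 := hv.abs_cubicCoef_le
  have h5 := hv.abs_quinticCoef_le
  refine (((hv.lipBound_amp.smul _).add (hv.lipBound_cube.smul _)).add
    (hv.lipBound_quint.smul _)).mono ?_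
  rw [abs_neg, abs_neg, abs_neg, abs_div, abs_div, abs_one, abs_of_pos (by norm_num : (0 : ℝ) < 3),
    abs_of_pos (by norm_num : (0 : ℝ) < 10)]
  linarith

lemma lipschitzWith_modeSpeed : LipschitzWith 10 (modeSpeed v) :=
  LipschitzWith.of_dist_le_mul fun s t => by
    rw [Real.dist_eq, Real.dist_eq]; exact hv.nearForce.abs_speed_sub_le s t

lemma abs_modeSpeed_le (s : ℝ) : |modeSpeed v s| ≤ (10 : ℝ≥0) := by
  rw [modeSpeed, abs_of_nonneg (speed_nonneg _ _)]
  exact hv.nearForce.speed_le s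

variable {w : ℝ → SeqSp} (hw : Correction w) {d : ℝ} (hd : ∀ s, ‖v s - w s‖ ≤ d)
include hw hd

omit hv hw in
lemma norm_amp_sub_le (s : ℝ) : ‖amp v s - amp w s‖ ≤ d := by
  have : amp v s - amp w s = v s - w s := by simp [amp]
  rw [this]; exact hd s

omit hv in
lemma norm_conv_amp_sub_le {p q : SeqSp} {c d' : ℝ} (s : ℝ) (hp : ‖p‖ ≤ c) (hpq : ‖p - q‖ ≤ d') :
    ‖conv 2 (amp v s) p - conv 2 (amp w s) q‖ ≤ d * c + 5 * d' := by
  have h0 := (norm_nonneg _).trans (hd 0)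
  refine (norm_conv_sub_conv_le one_le_two _ _ _ _).trans (add_le_add ?_ ?_)
  · exact mul_le_mul (norm_amp_sub_le hd s) hp (norm_nonneg _) h0
  · exact mul_le_mul (hw.lipBound_amp.bound s) hpq (norm_nonneg _) (by norm_num)

lemma norm_cube_sub_le (s : ℝ) : ‖cube 2 (amp v s) - cube 2 (amp w s)‖ ≤ 300 * d := by
  have h2 := norm_conv_amp_sub_le hw hd s (hv.lipBound_amp.bound s) (norm_amp_sub_le hd s)
  have := norm_conv_amp_sub_le hw hd s ((hv.lipBound_amp.conv hv.lipBound_amp).bound s) h2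
  rw [cube, cube]
  linarith [(norm_nonneg _).trans (hd 0)]

lemma norm_quint_sub_le (s : ℝ) : ‖quint 2 (amp v s) - quint 2 (amp w s)‖ ≤ 20000 * d := by
  have h4 := norm_conv_amp_sub_le hw hd s (hv.lipBound_cube.bound s)
    (norm_cube_sub_le hv hw hd s)
  have := norm_conv_amp_sub_le hw hd s ((hv.lipBound_amp.conv hv.lipBound_cube).bound s) h4
  rw [quint, quint]
  linarith [(norm_nonneg _).trans (hd 0)]

lemma abs_cubicMoment_sub_le (s : ℝ) : |cubicMoment v s - cubicMoment w s| ≤ 1000 * d := by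
  have h := norm_cube_sub_le hv hw hd s
  have h1 := abs_coord_le 1 (cube 2 (amp v s) - cube 2 (amp w s))
  have e : cubicMoment v s - cubicMoment w s =
      -(coord 1 (cube 2 (amp v s) - cube 2 (amp w s)) / 6) := by
    rw [map_sub, cubicMoment, cubicMoment]; ring
  rw [e, abs_neg, abs_div, abs_of_pos (by norm_num : (0 : ℝ) < 6), div_le_iff₀ (by norm_num)]
  linarith [(norm_nonneg _).trans (hd 0)]

lemma abs_quinticMoment_sub_le (s : ℝ) : |quinticMoment v s - quinticMoment w s| ≤ 1000 * d := by
  have h := norm_quint_sub_le hv hw hd s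
  have h1 := abs_coord_le 1 (quint 2 (amp v s) - quint 2 (amp w s))
  rw [quinticMoment, quinticMoment, ← sub_div, ← map_sub, abs_div,
    abs_of_pos (by norm_num : (0 : ℝ) < 20), div_le_iff₀ (by norm_num)]
  linarith

lemma abs_cubicCoef_sub_le : |cubicCoef v - cubicCoef w| ≤ 300 * (1000 * d) :=
  abs_coefThree_sub_coefThree_le hv.nearPow_cubicMoment hv.nearPow_quinticMoment
    hw.nearPow_cubicMoment hw.nearPow_quinticMoment
    (fun s _ => abs_cubicMoment_sub_le hv hw hd s) (fun s _ => abs_quinticMoment_sub_le hv hw hd s)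

lemma abs_quinticCoef_sub_le : |quinticCoef v - quinticCoef w| ≤ 300 * (1000 * d) :=
  abs_coefFive_sub_coefFive_le hv.nearPow_cubicMoment hv.nearPow_quinticMoment
    hw.nearPow_cubicMoment hw.nearPow_quinticMoment
    (fun s _ => abs_cubicMoment_sub_le hv hw hd s) (fun s _ => abs_quinticMoment_sub_le hv hw hd s)

lemma abs_modeSpeed_sub_le (s : ℝ) : |modeSpeed v s - modeSpeed w s| ≤ 4 * 10 ^ 6 * d := by
  have := hv.nearForce.abs_speed_sub_speed_le hw.nearForce (fun s hs =>
    abs_force_sub_force_le hv.nearPow_cubicMoment hv.nearPow_quinticMoment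
      hw.nearPow_cubicMoment hw.nearPow_quinticMoment
      (fun s _ => abs_cubicMoment_sub_le hv hw hd s)
      (fun s _ => abs_quinticMoment_sub_le hv hw hd s) hs) s
  refine this.trans (le_of_eq ?_)
  ring

lemma norm_nonlin_sub_le (s : ℝ) : ‖nonlin v s - nonlin w s‖ ≤ 2 * 10 ^ 9 * d := by
  have h0 := (norm_nonneg _).trans (hd 0)
  have h1 := norm_smul_sub_smul_le (-1) (-1) (amp v s) (amp w s)
  have h3 := norm_smul_sub_smul_le (-(cubicCoef v / 3)) (-(cubicCoef w / 3)) (cube 2 (amp v s))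
    (cube 2 (amp w s))
  have h5 := norm_smul_sub_smul_le (-(quinticCoef v / 10)) (-(quinticCoef w / 10))
    (quint 2 (amp v s)) (quint 2 (amp w s))
  have a1 := norm_amp_sub_le hd s
  rw [neg_sub_neg, ← sub_div, abs_neg, abs_div, abs_div, abs_sub_comm,
    abs_of_pos (by norm_num : (0 : ℝ) < 3)] at h3
  rw [neg_sub_neg, ← sub_div, abs_neg, abs_div, abs_div, abs_sub_comm,
    abs_of_pos (by norm_num : (0 : ℝ) < 10)] at h5
  have c3 := mul_le_mul (div_le_div_of_nonneg_right hv.abs_cubicCoef_le (by norm_num : (0 : ℝ) ≤ 3))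
    (norm_cube_sub_le hv hw hd s) (norm_nonneg _) (by norm_num)
  have c5 := mul_le_mul (div_le_div_of_nonneg_right hv.abs_quinticCoef_le
    (by norm_num : (0 : ℝ) ≤ 10)) (norm_quint_sub_le hv hw hd s) (norm_nonneg _) (by norm_num)
  have d3 := mul_le_mul (div_le_div_of_nonneg_right (abs_cubicCoef_sub_le hv hw hd)
    (by norm_num : (0 : ℝ) ≤ 3)) (hw.lipBound_cube.bound s) (norm_nonneg _) (by positivity)
  have d5 := mul_le_mul (div_le_div_of_nonneg_right (abs_quinticCoef_sub_le hv hw hd)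
    (by norm_num : (0 : ℝ) ≤ 10)) (hw.lipBound_quint.bound s) (norm_nonneg _) (by positivity)
  have e : nonlin v s - nonlin w s = ((-1 : ℝ) • amp v s - (-1 : ℝ) • amp w s) +
      ((-(cubicCoef v / 3)) • cube 2 (amp v s) - (-(cubicCoef w / 3)) • cube 2 (amp w s)) +
      ((-(quinticCoef v / 10)) • quint 2 (amp v s) -
        (-(quinticCoef w / 10)) • quint 2 (amp w s)) := by
    rw [nonlin, nonlin]; abel
  rw [e]
  refine (norm_add₃_le).trans ?_
  simp only [abs_neg, abs_one, one_mul, sub_self, abs_zero, zero_mul, add_zero] at h1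
  linarith

end Correction

/-- The decay rate of the `k`-th mode. -/
noncomputable def rate (k : ℤ) : ℝ := √((k : ℝ) ^ 2 - 1)

lemma one_le_rate {k : ℤ} (hk : 2 ≤ k.natAbs) : 1 ≤ rate k := by
  rw [rate]
  refine Real.le_sqrt_of_sq_le ?_
  have h1 : (2 : ℝ) ≤ |(k : ℝ)| := by
    rw [← Int.cast_abs, ← Nat.cast_natAbs]; exact_mod_cast hk
  have := sq_abs (k : ℝ)
  nlinarith

lemma rate_sq {k : ℤ} (hk : 2 ≤ k.natAbs) : rate k ^ 2 = (k : ℝ) ^ 2 - 1 := by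
  rw [rate, Real.sq_sqrt]
  by_contra! h
  have := one_le_rate hk
  rw [rate, Real.sqrt_eq_zero_of_nonpos h.le] at this
  linarith

/-- The multiplier of the resolvent kernel on the modes of order at least two. -/
noncomputable def kernelCoef (t : ℝ) (k : ℤ) : ℝ :=
  if 2 ≤ k.natAbs then exp (-rate k * |t|) / (2 * rate k) else 0

lemma abs_kernelCoef_le (t : ℝ) (k : ℤ) : |kernelCoef t k| ≤ exp (-|t|) / 2 := by
  rw [kernelCoef]
  split_ifs with hk
  · have h := one_le_rate hk
    rw [abs_of_nonneg (by positivity)]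
    have : exp (-rate k * |t|) ≤ exp (-|t|) := by
      apply exp_le_exp.2; nlinarith [abs_nonneg t]
    exact div_le_div₀ (exp_pos _).le this (by norm_num) (by linarith)
  · rw [abs_zero]; positivity

lemma abs_exp_neg_sub_le {x y : ℝ} (hx : 0 ≤ x) (hy : 0 ≤ y) :
    |exp (-x) - exp (-y)| ≤ |x - y| := by
  wlog h : x ≤ y generalizing x y
  · rw [abs_sub_comm, abs_sub_comm x]; exact this hy hx (not_le.1 h).le
  have h1 : exp (-y) ≤ exp (-x) := exp_le_exp.2 (by linarith)
  have h2 : exp (-y) = exp (-x) * exp (-(y - x)) := by rw [← exp_add]; ring_nf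
  have h3 := Real.add_one_le_exp (-(y - x))
  have h4 : exp (-x) ≤ 1 := exp_le_one_iff.2 (by linarith)
  rw [abs_of_nonneg (by linarith), abs_of_nonpos (by linarith), h2]
  nlinarith [exp_pos (-x)]

lemma abs_kernelCoef_sub_le (t t' : ℝ) (k : ℤ) :
    |kernelCoef t k - kernelCoef t' k| ≤ |t - t'| := by
  rw [kernelCoef, kernelCoef]
  split_ifs with hk
  · have h := one_le_rate hk
    rw [← sub_div, abs_div, abs_of_pos (by positivity : 0 < 2 * rate k),
      div_le_iff₀ (by positivity), neg_mul, neg_mul]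
    refine (abs_exp_neg_sub_le (by positivity) (by positivity)).trans ?_
    rw [← mul_sub, abs_mul, abs_of_pos (by positivity : 0 < rate k)]
    have := abs_abs_sub_abs_le t t'
    nlinarith [abs_nonneg (t - t')]
  · simp

/-- The resolvent kernel. -/
noncomputable def kernel (t : ℝ) : SeqSp →L[ℝ] SeqSp := diag (kernelCoef t)

lemma norm_kernel_le (t : ℝ) : ‖kernel t‖ ≤ exp (-|t|) / 2 := norm_diag_le (abs_kernelCoef_le t)

lemma coord_kernel (t : ℝ) (k : ℤ) (z : SeqSp) :
    coord k (kernel t z) = kernelCoef t k * coord k z :=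
  coord_diag (abs_kernelCoef_le t) k z

lemma continuous_kernel : Continuous kernel := by
  refine (LipschitzWith.of_dist_le_mul (K := 1) fun t t' => ?_).continuous
  rw [dist_eq_norm, Real.dist_eq, NNReal.coe_one, one_mul]
  refine clm_opNorm_le _ fun k => ?_
  rw [sub_apply, kernel, kernel, diag_unitVec (abs_kernelCoef_le t),
    diag_unitVec (abs_kernelCoef_le t'), ← sub_smul, norm_smul, norm_unitVec, mul_one]
  exact abs_kernelCoef_sub_le t t' k

lemma refl_kernel (t : ℝ) (z : SeqSp) : refl (kernel t z) = kernel t (refl z) := by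
  refine seq_ext fun k => ?_
  rw [coord_refl, coord_kernel, coord_kernel, coord_refl]
  simp [kernelCoef, rate]

lemma integral_exp_neg_abs : ∫ t : ℝ, exp (-(1 / 2) * |t|) / 2 = 2 := by
  rw [integral_div, integral_comp_abs (f := fun t => exp (-(1 / 2) * t)),
    integral_exp_mul_Ioi (by norm_num)]
  norm_num

lemma integrable_exp_neg_abs : Integrable fun t : ℝ => exp (-(1 / 2) * |t|) / 2 := by
  refine Integrable.of_integral_ne_zero ?_
  rw [integral_exp_neg_abs]; norm_num

lemma norm_integral_le_of_exp {f : ℝ → SeqSp} {C : ℝ}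
    (hf : ∀ t, ‖f t‖ ≤ C * (exp (-(1 / 2) * |t|) / 2)) : ‖∫ t, f t‖ ≤ 2 * C := by
  refine (norm_integral_le_of_norm_le (integrable_exp_neg_abs.const_mul C)
    (Eventually.of_forall hf)).trans (le_of_eq ?_)
  rw [integral_const_mul, integral_exp_neg_abs, mul_comm]

/-- The scale separation parameter. -/
noncomputable def eps : ℝ := 1 / 10 ^ 12

/-- The integrand of the fixed point operator. -/
noncomputable def integrand (v : ℝ → SeqSp) (s t : ℝ) : SeqSp :=
  kernel t (nonlin v (flow (modeSpeed v) (-(eps * t)) s))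

/-- The fixed point operator. -/
noncomputable def fixOp (v : ℝ → SeqSp) (s : ℝ) : SeqSp := eps ^ 2 • ∫ t, integrand v s t

lemma exp_neg_abs_le (t : ℝ) : exp (-|t|) ≤ exp (-(1 / 2) * |t|) :=
  exp_le_exp.2 (by linarith [abs_nonneg t])

namespace Correction

variable {v : ℝ → SeqSp} (hv : Correction v)
include hv

lemma continuous_integrand (s : ℝ) : Continuous (integrand v s) := by
  have h1 : Continuous fun t => flow (modeSpeed v) (-(eps * t)) s :=
    (continuous_flow hv.lipschitzWith_modeSpeed hv.abs_modeSpeed_le s).comp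
      (continuous_const.mul continuous_id).neg
  exact continuous_kernel.clm_apply (hv.lipBound_nonlin.continuous.comp h1)

lemma norm_integrand_le (s t : ℝ) :
    ‖integrand v s t‖ ≤ 21000 * (exp (-(1 / 2) * |t|) / 2) := by
  refine ((kernel t).le_opNorm _).trans ?_
  rw [mul_comm]
  refine mul_le_mul (hv.lipBound_nonlin.bound _) ((norm_kernel_le t).trans ?_) (norm_nonneg _)
    (by norm_num)
  linarith [exp_neg_abs_le t]

lemma integrable_integrand (s : ℝ) : Integrable (integrand v s) :=
  (integrable_exp_neg_abs.const_mul 21000).mono'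
    (hv.continuous_integrand s).aestronglyMeasurable
    (Eventually.of_forall (hv.norm_integrand_le s))

lemma norm_fixOp_sub_le {w : ℝ → SeqSp} (hw : Correction w) {d : ℝ}
    (hd : ∀ s, ‖v s - w s‖ ≤ d) (s s' : ℝ) :
    ‖fixOp v s - fixOp w s'‖ ≤ 2 / 10 ^ 10 * (d + |s - s'|) := by
  have hd0 := (norm_nonneg _).trans (hd 0)
  have hs0 := abs_nonneg (s - s')
  rw [fixOp, fixOp, ← smul_sub, norm_smul, ← integral_sub (hv.integrable_integrand s)
    (hw.integrable_integrand s')]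
  have key : ∀ t, ‖integrand v s t - integrand w s' t‖ ≤
      (10 ^ 13 * (d + |s - s'|)) * (exp (-(1 / 2) * |t|) / 2) := by
    intro t
    set x := flow (modeSpeed v) (-(eps * t)) s
    set y := flow (modeSpeed w) (-(eps * t)) s'
    have h1 : |x - y| ≤ (|s - s'| + 4 * 10 ^ 6 * d) * exp (((10 : ℝ≥0) : ℝ) * |-(eps * t)|) :=
      abs_flow_sub_flow_le (by norm_num) hv.lipschitzWith_modeSpeed hv.abs_modeSpeed_le
        hw.lipschitzWith_modeSpeed hw.abs_modeSpeed_le (abs_modeSpeed_sub_le hv hw hd) _ _ _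
    set X := exp (((10 : ℝ≥0) : ℝ) * |-(eps * t)|) with hX
    have hX1 : 1 ≤ X := Real.one_le_exp (by positivity)
    have h2 : ‖nonlin v x - nonlin w y‖ ≤ 10 ^ 13 * (d + |s - s'|) * X := by
      have e1 := norm_nonlin_sub_le hv hw hd x
      have e2 := hw.lipBound_nonlin.lip x y
      have e3 := norm_sub_le_norm_sub_add_norm_sub (nonlin v x) (nonlin w x) (nonlin w y)
      nlinarith [mul_nonneg hd0 (sub_nonneg.2 hX1), mul_nonneg hs0 (sub_nonneg.2 hX1)]
    have h3 : X * exp (-|t|) ≤ exp (-(1 / 2) * |t|) := by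
      rw [hX, ← exp_add]
      apply exp_le_exp.2
      rw [abs_neg, abs_mul, eps, abs_of_pos (by norm_num)]
      have := abs_nonneg t
      norm_num
      linarith
    rw [integrand, integrand, ← map_sub]
    refine ((kernel t).le_opNorm _).trans ?_
    calc ‖kernel t‖ * ‖nonlin v x - nonlin w y‖
        ≤ (exp (-|t|) / 2) * (10 ^ 13 * (d + |s - s'|) * X) :=
          mul_le_mul (norm_kernel_le t) h2 (norm_nonneg _) (by positivity)
      _ = (10 ^ 13 * (d + |s - s'|)) * ((X * exp (-|t|)) / 2) := by ring
      _ ≤ _ := by gcongr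
  have := norm_integral_le_of_exp key
  rw [Real.norm_eq_abs, eps, abs_of_pos (by norm_num)]
  linarith

lemma fixOp : Correction (fixOp v) where
  lip :=
    { bound := fun s => by
        have := norm_integral_le_of_exp (hv.norm_integrand_le s)
        rw [StripSolution.fixOp, norm_smul, Real.norm_eq_abs, eps, abs_of_pos (by norm_num)]
        linarith
      lip := fun s t => by
        have := hv.norm_fixOp_sub_le hv (d := 0) (by simp) s t
        linarith [abs_nonneg (s - t)] }
  zero := by
    have h0 : modeSpeed v 0 = 0 := speed_zero _
    have : ∀ t, integrand v 0 t = 0 := fun t => by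
      rw [integrand, flow_of_zero hv.lipschitzWith_modeSpeed hv.abs_modeSpeed_le h0,
        hv.nonlin_zero, map_zero]
    simp [StripSolution.fixOp, this]
  odd s := by
    have : ∀ t, refl (integrand v s t) = -integrand v s t := fun t => by
      rw [integrand, refl_kernel, hv.refl_nonlin, map_neg]
    rw [StripSolution.fixOp, map_smul, ← refl.integral_comp_comm (hv.integrable_integrand s),
      funext this, integral_neg, smul_neg]

/-- A correction as a bounded continuous function. -/
noncomputable def toBCF : BoundedContinuousFunction ℝ SeqSp :=
  BoundedContinuousFunction.ofNormedAddCommGroup v hv.lip.continuous _ hv.lip.bound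

end Correction

lemma isClosed_correction : IsClosed {f : BoundedContinuousFunction ℝ SeqSp | Correction f} := by
  have ev : ∀ s : ℝ, Continuous fun f : BoundedContinuousFunction ℝ SeqSp => f s := fun s =>
    continuous_eval_const s
  have : {f : BoundedContinuousFunction ℝ SeqSp | Correction f} =
      (⋂ s, {f | ‖f s‖ ≤ 4 / 10 ^ 9}) ∩ (⋂ s, ⋂ t, {f | ‖f s - f t‖ ≤ 4 / 10 ^ 9 * |s - t|}) ∩
        ({f | f 0 = 0} ∩ ⋂ s, {f | refl (f s) = -f s}) := by
    ext f
    simp only [Set.mem_inter_iff, Set.mem_iInter, Set.mem_ofPred_eq]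
    exact ⟨fun h => ⟨⟨h.lip.bound, h.lip.lip⟩, h.zero, h.odd⟩,
      fun h => ⟨⟨h.1.1, h.1.2⟩, h.2.1, h.2.2⟩⟩
  rw [this]
  refine IsClosed.inter (IsClosed.inter ?_ ?_) (IsClosed.inter ?_ ?_)
  · exact isClosed_iInter fun s => isClosed_le (ev s).norm continuous_const
  · exact isClosed_iInter fun s => isClosed_iInter fun t =>
      isClosed_le ((ev s).sub (ev t)).norm continuous_const
  · exact isClosed_eq (ev 0) continuous_const
  · exact isClosed_iInter fun s => isClosed_eq (refl.continuous.comp (ev s)) (ev s).neg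

lemma correction_zero : Correction fun _ => 0 where
  lip := ⟨fun s => by rw [norm_zero]; norm_num, fun s t => by simp⟩
  zero := rfl
  odd := by simp

/-- The fixed point equation is solvable. -/
lemma exists_fixed_point : ∃ v : ℝ → SeqSp, Correction v ∧ fixOp v = v := by
  let 𝒱 := {f : BoundedContinuousFunction ℝ SeqSp // Correction f}
  have : CompleteSpace 𝒱 := isClosed_correction.completeSpace_coe
  have : Nonempty 𝒱 := ⟨⟨correction_zero.toBCF, correction_zero⟩⟩
  let T : 𝒱 → 𝒱 := fun f => ⟨f.2.fixOp.toBCF, f.2.fixOp⟩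
  have hT : ContractingWith (1 / 2) T := by
    refine ⟨by norm_num, LipschitzWith.of_dist_le_mul fun f g => ?_⟩
    have hd : ∀ s, ‖f.1 s - g.1 s‖ ≤ dist f g := fun s => by
      rw [← dist_eq_norm]; exact BoundedContinuousFunction.dist_coe_le_dist s
    refine (BoundedContinuousFunction.dist_le (by positivity)).2 fun s => ?_
    have := f.2.norm_fixOp_sub_le g.2 hd s s
    rw [dist_eq_norm]
    refine this.trans ?_
    have h0 : 0 ≤ dist f g := dist_nonneg
    rw [sub_self, abs_zero, add_zero]
    push_cast
    linarith
  refine ⟨(ContractingWith.fixedPoint T hT).1, (ContractingWith.fixedPoint T hT).2, ?_⟩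
  exact congrArg (fun f : 𝒱 => (f.1 : ℝ → SeqSp)) hT.fixedPoint_isFixedPt

/-- The trajectory of the leading mode. -/
noncomputable def modePath (v : ℝ → SeqSp) (y : ℝ) : ℝ := flow (modeSpeed v) y (1 / 2)

/-- The profile in the variable along the strip. -/
noncomputable def profile (v : ℝ → SeqSp) (y : ℝ) : SeqSp := amp v (modePath v y)

lemma coord_sinVec_of_natAbs_ne {k : ℤ} (hk : k.natAbs ≠ 1) : coord k sinVec = 0 := by
  have h1 : k ≠ 1 := by rintro rfl; exact hk rfl
  have h2 : k ≠ -1 := by rintro rfl; exact hk rfl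
  simp [sinVec, expVec, coord_unitVec, h1, h2]

lemma coord_neg_of_refl {z : SeqSp} (hz : refl z = -z) (k : ℤ) : coord (-k) z = -coord k z := by
  rw [← coord_refl, hz, map_neg]

lemma coord_zero_of_refl {z : SeqSp} (hz : refl z = -z) : coord 0 z = 0 := by
  have := coord_neg_of_refl hz 0
  rw [neg_zero] at this
  linarith

namespace Correction

variable {v : ℝ → SeqSp} (hv : Correction v)
include hv

lemma modePath_mem (y : ℝ) : modePath v y ∈ Set.Ioo (0 : ℝ) 1 :=
  flow_mem_Ioo hv.lipschitzWith_modeSpeed hv.abs_modeSpeed_le (speed_zero _)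
    hv.nearForce.speed_one (by norm_num) y

lemma hasDerivAt_modePath (y : ℝ) : HasDerivAt (modePath v) (modeSpeed v (modePath v y)) y :=
  (flow_spec hv.lipschitzWith_modeSpeed hv.abs_modeSpeed_le _).2 y

lemma continuous_modePath : Continuous (modePath v) :=
  continuous_iff_continuousAt.2 fun y => (hv.hasDerivAt_modePath y).continuousAt

lemma hasDerivAt_modeSpeed_modePath (y : ℝ) :
    HasDerivAt (fun y => modeSpeed v (modePath v y)) (modeForce v (modePath v y)) y := by
  have h := hv.modePath_mem y
  have hp := (hv.nearForce.speed_pos h).ne'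
  refine ((hv.nearForce.hasDerivAt_speed h).comp y (hv.hasDerivAt_modePath y)).congr_deriv ?_
  exact div_mul_cancel₀ _ hp

lemma flow_modePath (t y : ℝ) : flow (modeSpeed v) t (modePath v y) = modePath v (y + t) := by
  rw [modePath, flow_flow hv.lipschitzWith_modeSpeed hv.abs_modeSpeed_le, add_comm, modePath]

lemma profile_eq (y : ℝ) : profile v y = modePath v y • sinVec + v (modePath v y) := by
  have h := hv.modePath_mem y
  rw [profile, amp, clamp_of_mem ⟨h.1.le, h.2.le⟩]

lemma continuous_profile : Continuous (profile v) :=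
  hv.lipBound_amp.continuous.comp hv.continuous_modePath

variable (hf : StripSolution.fixOp v = v)
include hf

lemma coord_eq (k : ℤ) (y : ℝ) : coord k (v (modePath v y)) = eps ^ 2 * ∫ t, kernelCoef t k *
    coord k (nonlin v (modePath v (y - eps * t))) := by
  rw [← congrFun hf (modePath v y), StripSolution.fixOp, map_smul,
    ← (coord k).integral_comp_comm (hv.integrable_integrand _), smul_eq_mul]
  simp only [integrand, coord_kernel, hv.flow_modePath, sub_eq_add_neg]

lemma coord_eq_zero {k : ℤ} (hk : ¬ 2 ≤ k.natAbs) (y : ℝ) : coord k (v (modePath v y)) = 0 := by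
  rw [coord_eq hv hf]
  simp [kernelCoef, hk]

lemma coord_one_nonlin (y : ℝ) :
    coord 1 (nonlin v (modePath v y)) = -2 * modeForce v (modePath v y) := by
  have h0 := coord_eq_zero hv hf (k := 1) (by simp) y
  rw [nonlin, modeForce, force, ← cubicCoef, ← quinticCoef]
  simp only [map_add, map_smul, smul_eq_mul, cubicMoment, quinticMoment]
  have : coord 1 (amp v (modePath v y)) = 2 * clamp (modePath v y) := by
    rw [amp, map_add, h0, map_smul, coord_one_sinVec, smul_eq_mul]; ring
  rw [this]
  ring

lemma exists_mode_equation (k : ℤ) : ∃ w : ℝ → ℝ,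
    (∀ y, HasDerivAt (fun y => coord k (profile v y)) (w y) y) ∧
    ∀ y, HasDerivAt w ((((k : ℝ) ^ 2 - 1) * coord k (profile v y) -
      eps ^ 2 * coord k (nonlin v (modePath v y))) / eps ^ 2) y := by
  have e0 : eps ≠ 0 := by norm_num [eps]
  by_cases hk : 2 ≤ k.natAbs
  · have hN := one_le_rate hk
    have hc : coord k sinVec = 0 := coord_sinVec_of_natAbs_ne (by omega)
    obtain ⟨w, h1, h2⟩ := exists_deriv_resolvent (N := rate k) (ε := eps) (by linarith)
      (by norm_num [eps]) (g := fun y => coord k (nonlin v (modePath v y))) (C := 21000)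
      (V := fun y => coord k (profile v y) / eps ^ 2)
      ((coord k).continuous.comp (hv.lipBound_nonlin.continuous.comp hv.continuous_modePath))
      (fun t => (abs_coord_le _ _).trans (hv.lipBound_nonlin.bound _))
      (fun y => by
        rw [hv.profile_eq, map_add, map_smul, hc, smul_zero, zero_add, coord_eq hv hf,
          mul_div_cancel_left₀ _ (pow_ne_zero 2 e0)]
        simp only [kernelCoef, if_pos hk])
    refine ⟨fun y => eps ^ 2 * w y, fun y => ?_, fun y => ?_⟩
    · refine (((h1 y).const_mul (eps ^ 2)).congr_of_eventuallyEq (Eventually.of_forall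
        fun y => ?_))
      simp only
      field_simp
    · refine ((h2 y).const_mul (eps ^ 2)).congr_deriv ?_
      rw [rate_sq hk]
      field_simp
  · have hz : ∀ y, coord k (profile v y) = modePath v y * coord k sinVec := fun y => by
      rw [hv.profile_eq, map_add, coord_eq_zero hv hf hk, add_zero, map_smul, smul_eq_mul]
    have hF : ∀ y, ((k : ℝ) ^ 2 - 1) * coord k (profile v y) = 0 ∧
        coord k (nonlin v (modePath v y)) = -coord k sinVec * modeForce v (modePath v y) := by
      intro y
      have h1 := coord_one_nonlin hv hf y
      have h2 := coord_neg_of_refl (hv.refl_nonlin (modePath v y)) 1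
      have h3 := coord_zero_of_refl (hv.refl_nonlin (modePath v y))
      have h4 := coord_neg_of_refl refl_sinVec 1
      have h5 := coord_zero_of_refl refl_sinVec
      rw [hz]
      obtain rfl | rfl | rfl : k = 0 ∨ k = 1 ∨ k = -1 := by omega
      · simp [h3, h5]
      · simp [h1, coord_one_sinVec]
      · rw [h2, h1, h4, coord_one_sinVec]; simp
    refine ⟨fun y => modeSpeed v (modePath v y) * coord k sinVec, fun y => ?_, fun y => ?_⟩
    · rw [funext hz]
      exact (hv.hasDerivAt_modePath y).mul_const _
    · refine ((hv.hasDerivAt_modeSpeed_modePath y).mul_const _).congr_deriv ?_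
      rw [(hF y).1, (hF y).2]
      field_simp
      ring

end Correction

/-- The polynomial nonlinearity in exponentially weighted coordinates. -/
noncomputable def oddPoly (r c₁ c₃ c₅ : ℝ) (a : SeqSp) : SeqSp :=
  c₁ • a + c₃ • cube r a + c₅ • quint r a

lemma contDiff_oddPoly {n : ℕ} (r c₁ c₃ c₅ : ℝ) {a : ℝ → SeqSp} (ha : ContDiff ℝ n a) :
    ContDiff ℝ n fun y => oddPoly r c₁ c₃ c₅ (a y) := by
  have hc : ∀ {b c : ℝ → SeqSp}, ContDiff ℝ n b → ContDiff ℝ n c →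
      ContDiff ℝ n fun y => conv r (b y) (c y) := fun hb hc =>
    ((conv r).contDiff.comp hb).clm_apply hc
  have h3 : ContDiff ℝ n fun y => cube r (a y) := hc ha (hc ha ha)
  have h5 : ContDiff ℝ n fun y => quint r (a y) := hc ha (hc ha h3)
  exact ((ha.const_smul c₁).add (h3.const_smul c₃)).add (h5.const_smul c₅)

lemma reweight_oddPoly {r : ℝ} (hr : 1 ≤ r) (hr2 : r ≤ 2) (c₁ c₃ c₅ : ℝ) (a : SeqSp) :
    reweight r (oddPoly 2 c₁ c₃ c₅ a) = oddPoly r c₁ c₃ c₅ (reweight r a) := by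
  simp only [oddPoly, cube, quint, map_add, map_smul, reweight_conv hr hr2]

lemma coord_reweight {r : ℝ} (hr : 1 ≤ r) (hr2 : r ≤ 2) (k : ℤ) (z : SeqSp) :
    coord k (reweight r z) = (r / 2) ^ k.natAbs * coord k z :=
  coord_diag (abs_reweight_le hr hr2) k z

lemma refl_reweight {r : ℝ} (hr : 1 ≤ r) (hr2 : r ≤ 2) (z : SeqSp) :
    refl (reweight r z) = reweight r (refl z) := by
  refine seq_ext fun k => ?_
  rw [coord_refl, coord_reweight hr hr2, coord_reweight hr hr2, coord_refl, Int.natAbs_neg]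

/-- The multiplier of `-d²/dx² - 1`, combined with a change of weight from `r'` to `r`. -/
noncomputable def lapCoef (r r' : ℝ) (k : ℤ) : ℝ := ((k : ℝ) ^ 2 - 1) * (r / r') ^ k.natAbs

lemma exists_abs_lapCoef_le {r r' : ℝ} (hr : 0 < r) (hr' : r < r') :
    ∃ c, ∀ k, |lapCoef r r' k| ≤ c := by
  have h1 : 1 < r' / r := (one_lt_div hr).2 hr'
  obtain ⟨c, hc, h⟩ := exists_pow_mul_le h1 2
  refine ⟨c + 1, fun k => ?_⟩
  have hp : (r / r') ^ k.natAbs = ((r' / r) ^ k.natAbs)⁻¹ := by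
    rw [← inv_pow, inv_div]
  have hk : ((k.natAbs : ℕ) : ℝ) ^ 2 = (k : ℝ) ^ 2 := by
    rw [Nat.cast_natAbs, Int.cast_abs, sq_abs]
  have h2 := h k.natAbs
  have h3 : ((r' / r) ^ k.natAbs)⁻¹ ≤ 1 := inv_le_one_of_one_le₀ (one_le_pow₀ h1.le)
  have h4 : 0 < ((r' / r) ^ k.natAbs)⁻¹ := by have := hr.trans hr'; positivity
  rw [hk] at h2
  have h5 : 0 ≤ (k : ℝ) ^ 2 * ((r' / r) ^ k.natAbs)⁻¹ := by positivity
  rw [lapCoef, hp, abs_le]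
  constructor <;> linarith

/-- The second derivative of the profile in the weight `r`, in terms of the weight `r'` used for
the linear part. -/
noncomputable def accel (v : ℝ → SeqSp) (r r' : ℝ) (y : ℝ) : SeqSp :=
  (eps ^ 2)⁻¹ • diag (lapCoef r r') (reweight r' (profile v y)) -
    oddPoly r (-1) (-(cubicCoef v / 3)) (-(quinticCoef v / 10)) (reweight r (profile v y))

lemma coord_accel {v : ℝ → SeqSp} {r r' : ℝ} (hr : 1 ≤ r) (hr' : r < r') (hr2 : r' ≤ 2) (k : ℤ)
    (y : ℝ) : coord k (accel v r r' y) = (r / 2) ^ k.natAbs *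
      ((((k : ℝ) ^ 2 - 1) * coord k (profile v y) -
        eps ^ 2 * coord k (nonlin v (modePath v y))) / eps ^ 2) := by
  have e0 : eps ≠ 0 := by norm_num [eps]
  obtain ⟨c, hc⟩ := exists_abs_lapCoef_le (by linarith : 0 < r) hr'
  have h : oddPoly r (-1) (-(cubicCoef v / 3)) (-(quinticCoef v / 10)) (reweight r (profile v y)) =
      reweight r (nonlin v (modePath v y)) := (reweight_oddPoly hr (by linarith) _ _ _ _).symm
  rw [accel, h, map_sub, map_smul, coord_diag hc, coord_reweight hr (by linarith),
    coord_reweight (by linarith) hr2, lapCoef, smul_eq_mul]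
  have h2 : (r / r') ^ k.natAbs * (r' / 2) ^ k.natAbs = (r / 2) ^ k.natAbs := by
    rw [← mul_pow]; congr 1; field_simp [(by linarith : r' ≠ 0)]
  rw [← h2]
  field_simp

lemma contDiff_accel {v : ℝ → SeqSp} {n : ℕ} {r r' : ℝ}
    (h : ContDiff ℝ n fun y => reweight r (profile v y))
    (h' : ContDiff ℝ n fun y => reweight r' (profile v y)) : ContDiff ℝ n (accel v r r') := by
  refine ContDiff.sub (ContDiff.const_smul _ ?_) (contDiff_oddPoly _ _ _ _ h)
  exact (diag (lapCoef r r')).contDiff.comp h'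

namespace Correction

variable {v : ℝ → SeqSp} (hv : Correction v) (hf : StripSolution.fixOp v = v)
include hv hf

lemma exists_deriv_reweight_profile {r r' : ℝ} (hr : 1 ≤ r) (hr' : r < r') (hr2 : r' ≤ 2) :
    ∃ z : ℝ → SeqSp, (∀ y, HasDerivAt (fun y => reweight r (profile v y)) (z y) y) ∧
      ∀ y, HasDerivAt z (accel v r r' y) y := by
  choose w h1 h2 using exists_mode_equation hv hf
  have c : ∀ r, Continuous fun y => reweight r (profile v y) := fun r =>
    (reweight r).continuous.comp hv.continuous_profile
  refine twice_differentiable_of_coord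
    (contDiff_zero.1 (contDiff_accel (n := 0) (contDiff_zero.2 (c r))
      (contDiff_zero.2 (c r')))) (w := fun k y => (r / 2) ^ k.natAbs * w k y)
    (fun k y => ?_) (fun k y => ?_)
  · simp only [coord_reweight hr (hr'.le.trans hr2)]
    exact (h1 k y).const_mul _
  · rw [coord_accel hr hr' hr2]
    exact (h2 k y).const_mul _

lemma contDiff_reweight_profile {r : ℝ} (hr : 1 ≤ r) (hr2 : r < 2) :
    ContDiff ℝ (⊤ : ℕ∞) fun y => reweight r (profile v y) := by
  rw [contDiff_infty]
  have key : ∀ n : ℕ, ∀ r : ℝ, 1 ≤ r → r < 2 →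
      ContDiff ℝ (2 * n : ℕ) fun y => reweight r (profile v y) := by
    intro n
    induction n with
    | zero =>
      intro r _ _
      exact contDiff_zero.2 ((reweight r).continuous.comp hv.continuous_profile)
    | succ n ih =>
      intro r hr hr2
      obtain ⟨z, h1, h2⟩ := exists_deriv_reweight_profile hv hf hr
        (by linarith : r < (r + 2) / 2) (by linarith)
      exact contDiff_add_two h1 h2 (contDiff_accel (ih r hr hr2)
        (ih _ (by linarith) (by linarith)))
  intro n
  exact (key n r hr hr2).of_le (by exact_mod_cast (by omega : n ≤ 2 * n))

end Correction

lemma norm_deriv_le_of_norm_sub_le {E : Type*} [NormedAddCommGroup E] [NormedSpace ℝ E]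
    {f : ℝ → E} {g : ℝ → ℝ} {f' : E} {g' c x : ℝ} (hf : HasDerivAt f f' x) (hg : HasDerivAt g g' x)
    (h : ∀ y, ‖f y - f x‖ ≤ c * |g y - g x|) : ‖f'‖ ≤ c * |g'| := by
  refine le_of_tendsto_of_tendsto (hasDerivAt_iff_tendsto_slope.1 hf).norm
    ((hasDerivAt_iff_tendsto_slope.1 hg).abs.const_mul c) (Eventually.of_forall fun y => ?_)
  simp only [slope, vsub_eq_sub, norm_smul, smul_eq_mul, abs_mul, Real.norm_eq_abs]
  have := mul_le_mul_of_nonneg_left (h y) (abs_nonneg (y - x)⁻¹)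
  linarith

lemma norm_reweight_le {r : ℝ} (hr : 1 ≤ r) (hr2 : r ≤ 2) (z : SeqSp) : ‖reweight r z‖ ≤ ‖z‖ := by
  have h := (reweight r).le_of_opNorm_le (norm_diag_le (abs_reweight_le hr hr2)) z
  rwa [one_mul] at h

/-- The sequence of the function `sin` in the weight `3 / 2`. -/
noncomputable def baseVec : SeqSp := reweight (3 / 2) sinVec

lemma baseVec_eq : baseVec = (3 / 2 : ℝ) • unitVec 1 - (3 / 2 : ℝ) • unitVec (-1) := by
  rw [baseVec, sinVec, expVec, expVec, map_sub, map_smul, map_smul,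
    reweight_unitVec (by norm_num) (by norm_num), reweight_unitVec (by norm_num) (by norm_num),
    smul_smul, smul_smul]
  norm_num

lemma sinEval_zero_baseVec (x : ℝ) : sinEval (3 / 2) 0 x baseVec = sin x := by
  rw [baseVec_eq, map_sub, map_smul, map_smul, sinEval_zero_unitVec (by norm_num),
    sinEval_zero_unitVec (by norm_num)]
  norm_num
  ring

lemma sinEval_one_baseVec (x : ℝ) : sinEval (3 / 2) 1 x baseVec = cos x := by
  rw [baseVec_eq, map_sub, map_smul, map_smul, sinEval_one_unitVec (by norm_num),
    sinEval_one_unitVec (by norm_num)]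
  norm_num
  ring

/-- A curve of odd sequences solving the second order system for the Fourier coefficients, close to
a monotone multiple of the first mode. -/
theorem exists_profile : ∃ (z z' z'' : ℝ → SeqSp) (s s' : ℝ → ℝ) (c₃ c₅ : ℝ),
    ContDiff ℝ (⊤ : ℕ∞) z ∧ (∀ y, HasDerivAt z (z' y) y) ∧ (∀ y, HasDerivAt z' (z'' y) y) ∧
    (∀ y, refl (z y) = -z y) ∧
    (∀ (k : ℤ) (y : ℝ), eps ^ 2 * coord k (z'' y) = ((k : ℝ) ^ 2 - 1) * coord k (z y) -
      eps ^ 2 * coord k (oddPoly (3 / 2) (-1) c₃ c₅ (z y))) ∧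
    (∀ y, s y ∈ Set.Ioo (0 : ℝ) 1) ∧ (∀ y, s' y ∈ Set.Ioc (0 : ℝ) 10) ∧
    (∀ y, ‖z y - s y • baseVec‖ ≤ s y) ∧ ∀ y, ‖z' y - s' y • baseVec‖ ≤ s' y := by
  obtain ⟨v, hv, hf⟩ := exists_fixed_point
  obtain ⟨z', h1, h2⟩ := hv.exists_deriv_reweight_profile hf (r := 3 / 2) (r' := 7 / 4)
    (by norm_num) (by norm_num) (by norm_num)
  have e0 : eps ≠ 0 := by norm_num [eps]
  have hle : ∀ z, ‖reweight (3 / 2) z‖ ≤ ‖z‖ := norm_reweight_le (by norm_num) (by norm_num)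
  have hz : ∀ y, reweight (3 / 2) (profile v y) - modePath v y • baseVec =
      reweight (3 / 2) (v (modePath v y)) := fun y => by
    rw [hv.profile_eq, map_add, map_smul, ← baseVec, add_sub_cancel_left]
  have hs : ∀ y, modeSpeed v (modePath v y) ∈ Set.Ioc (0 : ℝ) 10 := fun y =>
    ⟨hv.nearForce.speed_pos (hv.modePath_mem y), (le_abs_self _).trans (hv.abs_modeSpeed_le _)⟩
  have hlip : ∀ a b, ‖v a - v b‖ ≤ 1 * |a - b| := fun a b =>
    (hv.lip.lip a b).trans (by gcongr; norm_num)
  refine ⟨fun y => reweight (3 / 2) (profile v y), z', accel v (3 / 2) (7 / 4), modePath v,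
    fun y => modeSpeed v (modePath v y), -(cubicCoef v / 3), -(quinticCoef v / 10),
    hv.contDiff_reweight_profile hf (by norm_num) (by norm_num), h1, h2, fun y => ?_,
    fun k y => ?_, hv.modePath_mem, hs, fun y => ?_, fun y => ?_⟩
  · change refl (reweight (3 / 2) (profile v y)) = -reweight (3 / 2) (profile v y)
    rw [refl_reweight (by norm_num) (by norm_num), profile, hv.refl_amp, map_neg]
  · have h : oddPoly (3 / 2) (-1) (-(cubicCoef v / 3)) (-(quinticCoef v / 10))
        (reweight (3 / 2) (profile v y)) = reweight (3 / 2) (nonlin v (modePath v y)) :=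
      (reweight_oddPoly (by norm_num) (by norm_num) _ _ _ _).symm
    rw [h, coord_accel (by norm_num) (by norm_num) (by norm_num),
      coord_reweight (by norm_num) (by norm_num), coord_reweight (by norm_num) (by norm_num)]
    field_simp
  · rw [hz]
    have h := hlip (modePath v y) 0
    rw [hv.zero, sub_zero, sub_zero, one_mul, abs_of_pos (hv.modePath_mem y).1] at h
    exact (hle _).trans h
  · have hd := (h1 y).sub ((hv.hasDerivAt_modePath y).smul_const baseVec)
    have h := norm_deriv_le_of_norm_sub_le (c := 1) hd (hv.hasDerivAt_modePath y) fun x => by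
      simp only [Pi.sub_apply]
      rw [hz, hz, ← map_sub]
      exact (hle _).trans (hlip _ _)
    rwa [one_mul, abs_of_pos (hs y).1] at h

lemma pd1_eq_of_hasDerivAt {u : ℝ × ℝ → ℝ} {p : ℝ × ℝ} {d : ℝ} (hu : DifferentiableAt ℝ u p)
    (h : HasDerivAt (fun t => u (t, p.2)) d p.1) : pd1 u p = d :=
  (hu.hasFDerivAt.comp_hasDerivAt p.1
    ((hasDerivAt_id p.1).prodMk (hasDerivAt_const p.1 p.2))).unique h

lemma pd2_eq_of_hasDerivAt {u : ℝ × ℝ → ℝ} {p : ℝ × ℝ} {d : ℝ} (hu : DifferentiableAt ℝ u p)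
    (h : HasDerivAt (fun t => u (p.1, t)) d p.2) : pd2 u p = d :=
  (hu.hasFDerivAt.comp_hasDerivAt p.2
    ((hasDerivAt_const p.2 p.1).prodMk (hasDerivAt_id p.2))).unique h

/-- The function on the strip with Fourier coefficients `z`, and its derivatives in the first
variable. -/
noncomputable def field (z : ℝ → SeqSp) (n : ℕ) (a b c : ℝ) (p : ℝ × ℝ) : ℝ :=
  c * sinEval (3 / 2) n (a * p.1) (z (b * p.2))

section Field

variable {z z' : ℝ → SeqSp} (n : ℕ) (a b c : ℝ) (p : ℝ × ℝ)

lemma contDiff_field {m : ℕ∞} (hz : ContDiff ℝ m z) : ContDiff ℝ m (field z n a b c) :=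
  contDiff_const.mul ((((contDiff_sinEval (by norm_num) n).of_le (by exact_mod_cast le_top)).comp
    (contDiff_const.mul contDiff_fst)).clm_apply (hz.comp (contDiff_const.mul contDiff_snd)))

variable (h : ∀ y, HasDerivAt z (z' y) y)
include h

lemma differentiableAt_field : DifferentiableAt ℝ (field z n a b c) p := by
  have h1 : DifferentiableAt ℝ (fun p : ℝ × ℝ => sinEval (3 / 2) n (a * p.1)) p :=
    DifferentiableAt.comp (g := sinEval (3 / 2) n) (f := fun p : ℝ × ℝ => a * p.1) p
      (hasDerivAt_sinEval (by norm_num) n (a * p.1)).differentiableAt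
      (differentiableAt_fst.const_mul a)
  have h2 : DifferentiableAt ℝ (fun p : ℝ × ℝ => z (b * p.2)) p :=
    (h (b * p.2)).differentiableAt.comp p (differentiableAt_snd.const_mul b)
  exact (h1.clm_apply h2).const_mul c

lemma pd1_field : pd1 (field z n a b c) p = field z (n + 1) a b (c * a) p := by
  refine pd1_eq_of_hasDerivAt (differentiableAt_field n a b c p h) ?_
  have h1 : HasDerivAt (fun t => sinEval (3 / 2) n (a * t)) (a • sinEval (3 / 2) (n + 1) (a * p.1))
      p.1 :=
    ((hasDerivAt_sinEval (by norm_num) n (a * p.1)).scomp p.1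
      ((hasDerivAt_id p.1).const_mul a)).congr_deriv (by rw [mul_one])
  refine ((h1.clm_apply (hasDerivAt_const p.1 (z (b * p.2)))).const_mul c).congr_deriv ?_
  rw [field, map_zero, add_zero, smul_apply, smul_eq_mul, mul_assoc]

lemma pd2_field : pd2 (field z n a b c) p = field z' n a b (c * b) p := by
  refine pd2_eq_of_hasDerivAt (differentiableAt_field n a b c p h) ?_
  have h1 : HasDerivAt (fun t => z (b * t)) (b • z' (b * p.2)) p.2 :=
    ((h (b * p.2)).scomp p.2 ((hasDerivAt_id p.2).const_mul b)).congr_deriv (by rw [mul_one])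
  refine (((sinEval (3 / 2) n (a * p.1)).hasFDerivAt.comp_hasDerivAt p.2 h1).const_mul
    c).congr_deriv ?_
  rw [field, map_smul, smul_eq_mul, mul_assoc]

lemma lap2_field {z'' : ℝ → SeqSp} (h' : ∀ y, HasDerivAt z' (z'' y) y) :
    lap2 (field z n a b c) p =
      field z (n + 2) a b (c * a ^ 2) p + field z'' n a b (c * b ^ 2) p := by
  rw [lap2, (funext fun p => pd1_field n a b c p h : pd1 (field z n a b c) = _),
    (funext fun p => pd2_field n a b c p h : pd2 (field z n a b c) = _), ← pd1, ← pd2,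
    pd1_field _ _ _ _ _ h, pd2_field _ _ _ _ _ h']
  ring_nf

end Field

lemma sinEval_two_add {z z'' : SeqSp} {c₃ c₅ : ℝ} (hz : refl z = -z)
    (h : ∀ k : ℤ, eps ^ 2 * coord k z'' = ((k : ℝ) ^ 2 - 1) * coord k z -
      eps ^ 2 * coord k (oddPoly (3 / 2) (-1) c₃ c₅ z)) (x : ℝ) :
    sinEval (3 / 2) 2 x z + eps ^ 2 * sinEval (3 / 2) 0 x z'' = -(sinEval (3 / 2) 0 x z +
      eps ^ 2 * (-sinEval (3 / 2) 0 x z - 4 * c₃ * sinEval (3 / 2) 0 x z ^ 3 +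
        16 * c₅ * sinEval (3 / 2) 0 x z ^ 5)) := by
  rw [sinEval_two (by norm_num) (z' := -z - eps ^ 2 • oddPoly (3 / 2) (-1) c₃ c₅ z - eps ^ 2 • z'')]
  · simp only [oddPoly, map_sub, map_neg, map_add, map_smul, smul_eq_mul,
      sinEval_cube (by norm_num : (1 : ℝ) < 3 / 2) x hz,
      sinEval_quint (by norm_num : (1 : ℝ) < 3 / 2) x hz]
    ring
  · intro k
    simp only [map_sub, map_neg, map_smul, smul_eq_mul]
    rw [h]
    ring

lemma abs_sinEval_zero_sub_le {z : SeqSp} {s : ℝ} (h : ‖z - s • baseVec‖ ≤ s) (x : ℝ) :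
    |sinEval (3 / 2) 0 x z - s * sin x| ≤ 1 / 2 * |sin x| * s := by
  have := (abs_sinEval_zero_le x (z - s • baseVec)).trans
    (mul_le_mul_of_nonneg_left h (by positivity))
  rwa [map_sub, map_smul, sinEval_zero_baseVec, smul_eq_mul] at this

lemma abs_sinEval_one_sub_le {z : SeqSp} {s : ℝ} (h : ‖z - s • baseVec‖ ≤ s) (x : ℝ) :
    |sinEval (3 / 2) 1 x z - s * cos x| ≤ 1 / 2 * s := by
  have := (abs_sinEval_one_le x (z - s • baseVec)).trans
    (mul_le_mul_of_nonneg_left h (by positivity))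
  rwa [map_sub, map_smul, sinEval_one_baseVec, smul_eq_mul] at this

lemma abs_sinEval_zero_le_of_near {z : SeqSp} {s : ℝ} (h : ‖z - s • baseVec‖ ≤ s) (x : ℝ) :
    |sinEval (3 / 2) 0 x z| ≤ 3 / 2 * s := by
  have hs := (norm_nonneg _).trans h
  have h1 := abs_le.1 (abs_sinEval_zero_sub_le h x)
  have h2 := abs_le.1 (abs_sin_le_one x)
  have h3 := abs_sin_le_one x
  have h4 : 1 / 2 * |sin x| * s ≤ 1 / 2 * s := by nlinarith
  rw [abs_le]
  constructor <;> nlinarith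

lemma abs_sinEval_one_le_of_near {z : SeqSp} {s : ℝ} (h : ‖z - s • baseVec‖ ≤ s) (x : ℝ) :
    |sinEval (3 / 2) 1 x z| ≤ 3 / 2 * s := by
  have hs := (norm_nonneg _).trans h
  have h1 := abs_le.1 (abs_sinEval_one_sub_le h x)
  have h2 := abs_le.1 (abs_cos_le_one x)
  rw [abs_le]
  constructor <;> nlinarith

lemma sinEval_zero_pos {z : SeqSp} {s : ℝ} (h : ‖z - s • baseVec‖ ≤ s) (hs : 0 < s) {x : ℝ}
    (hx : 0 < sin x) : 0 < sinEval (3 / 2) 0 x z := by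
  have h1 := abs_le.1 (abs_sinEval_zero_sub_le h x)
  rw [abs_of_pos hx] at h1
  nlinarith [mul_pos hs hx]

lemma sinEval_one_ne_zero {z : SeqSp} {s : ℝ} (h : ‖z - s • baseVec‖ ≤ s) (hs : 0 < s) {x : ℝ}
    (hx : |cos x| = 1) : sinEval (3 / 2) 1 x z ≠ 0 := by
  intro h0
  have h1 := abs_sinEval_one_sub_le h x
  rw [h0, zero_sub, abs_neg, abs_mul, hx, abs_of_pos hs] at h1
  linarith

lemma sinEval_zero_eq_zero {x : ℝ} (hx : sin x = 0) (z : SeqSp) : sinEval (3 / 2) 0 x z = 0 := by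
  have h := abs_sinEval_zero_le x z
  rw [hx, abs_zero, mul_zero, zero_mul] at h
  exact abs_nonpos_iff.1 h

end StripSolution

open StripSolution Real Filter in
/-- there are a smooth odd `f` and a bounded smooth solution of `-Δu = f(u)` in
the strip `(0,1) × ℝ`, vanishing on the lateral boundary, with bounded and nowhere vanishing
gradient on the closed strip, which is not one-dimensional. -/
theorem strip_solution_no_critical_points :
    ∃ f : ℝ → ℝ, ∃ u : ℝ × ℝ → ℝ,
      ContDiff ℝ (⊤ : ℕ∞) f ∧ (∀ t : ℝ, f (-t) = -f t) ∧
      ContDiffOn ℝ (⊤ : ℕ∞) u (Set.Icc (0:ℝ) 1 ×ˢ (Set.univ : Set ℝ)) ∧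
      (∃ M : ℝ, ∀ p ∈ Set.Icc (0:ℝ) 1 ×ˢ (Set.univ : Set ℝ), |u p| ≤ M) ∧
      (∀ p ∈ Set.Ioo (0:ℝ) 1 ×ˢ (Set.univ : Set ℝ), -lap2 u p = f (u p)) ∧
      (∀ x₂ : ℝ, u (0, x₂) = 0 ∧ u (1, x₂) = 0) ∧
      (∃ M : ℝ, ∀ p ∈ Set.Icc (0:ℝ) 1 ×ˢ (Set.univ : Set ℝ), ‖grad2 u p‖ ≤ M) ∧
      (∀ p ∈ Set.Icc (0:ℝ) 1 ×ˢ (Set.univ : Set ℝ), grad2 u p ≠ 0) ∧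
      ¬ ∃ e : ℝ × ℝ, ‖e‖ = 1 ∧ ∃ g : ℝ → ℝ,
        ∀ p ∈ Set.Icc (0:ℝ) 1 ×ˢ (Set.univ : Set ℝ), u p = g (p.1 * e.1 + p.2 * e.2) := by
  obtain ⟨z, z', z'', s, s', c₃, c₅, hz, h1, h2, hodd, heq, hs, hs', hn, hn'⟩ := exists_profile
  have hπ := Real.pi_pos
  have heps : 0 < eps := by norm_num [eps]
  set b := eps * π with hb
  have hb0 : 0 < b := mul_pos heps hπ
  have hp1 : ∀ p, pd1 (field z 0 π b 1) p = π * sinEval (3 / 2) 1 (π * p.1) (z (b * p.2)) :=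
    fun p => by rw [pd1_field _ _ _ _ _ h1, field, one_mul]
  have hp2 : ∀ p, pd2 (field z 0 π b 1) p = b * sinEval (3 / 2) 0 (π * p.1) (z' (b * p.2)) :=
    fun p => by rw [pd2_field _ _ _ _ _ h1, field, one_mul]
  have hsin : ∀ {x : ℝ}, x ∈ Set.Ioo (0 : ℝ) 1 → 0 < sin (π * x) := fun {x} hx =>
    sin_pos_of_pos_of_lt_pi (mul_pos hπ hx.1) (by nlinarith [hx.2])
  have hpos : ∀ x y : ℝ, x ∈ Set.Ioo (0 : ℝ) 1 → 0 < pd2 (field z 0 π b 1) (x, y) := by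
    intro x y hx
    rw [hp2]
    exact mul_pos hb0 (sinEval_zero_pos (hn' _) (hs' _).1 (hsin hx))
  have hbd : ∀ y, field z 0 π b 1 (0, y) = 0 ∧ field z 0 π b 1 (1, y) = 0 := fun y => by
    simp only [field, one_mul]
    exact ⟨sinEval_zero_eq_zero (by simp) _, sinEval_zero_eq_zero (by simp) _⟩
  refine ⟨fun t => π ^ 2 * (t + eps ^ 2 * (-t - 4 * c₃ * t ^ 3 + 16 * c₅ * t ^ 5)),
    field z 0 π b 1, by fun_prop, fun t => by ring, (contDiff_field 0 π b 1 hz).contDiffOn,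
    ⟨3 / 2, fun p _ => ?_⟩, fun p _ => ?_, hbd, ⟨π * 2 + b * 15, fun p _ => ?_⟩,
    fun p hp h0 => ?_, ?_⟩
  · rw [field, one_mul]
    refine (abs_sinEval_zero_le_of_near (hn _) _).trans ?_
    linarith [(hs (b * p.2)).2]
  · rw [lap2_field _ _ _ _ _ h1 h2, field, field, field, one_mul, one_mul, one_mul]
    have h := sinEval_two_add (hodd (b * p.2)) (fun k => heq k (b * p.2)) (π * p.1)
    rw [hb] at h ⊢
    linear_combination (-π ^ 2) * h
  · have k1 := abs_sinEval_one_le_of_near (hn (b * p.2)) (π * p.1)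
    have k2 := abs_sinEval_zero_le_of_near (hn' (b * p.2)) (π * p.1)
    have j1 := (hs (b * p.2)).2
    have j2 := (hs' (b * p.2)).2
    rw [grad2, hp1, hp2, Prod.norm_mk, Real.norm_eq_abs, Real.norm_eq_abs, abs_mul, abs_mul,
      abs_of_pos hπ, abs_of_pos hb0]
    have i1 := mul_le_mul_of_nonneg_left (k1.trans (by linarith : _ ≤ (2 : ℝ))) hπ.le
    have i2 := mul_le_mul_of_nonneg_left (k2.trans (by linarith : _ ≤ (15 : ℝ))) hb0.le
    exact max_le (by linarith) (by linarith)
  · obtain ⟨x, y⟩ := p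
    rw [grad2, Prod.mk_eq_zero] at h0
    have hx := hp.1
    by_cases hx' : x ∈ Set.Ioo (0 : ℝ) 1
    · exact (hpos x y hx').ne' h0.2
    · have hc : |cos (π * x)| = 1 := by
        obtain rfl | rfl : x = 0 ∨ x = 1 := by
          by_contra! h
          exact hx' ⟨lt_of_le_of_ne hx.1 h.1.symm, lt_of_le_of_ne hx.2 h.2⟩
        · simp
        · simp
      rw [hp1] at h0
      exact sinEval_one_ne_zero (hn _) (hs _).1 hc ((mul_eq_zero.1 h0.1).resolve_left hπ.ne')
  · rintro ⟨e, -, g, hg⟩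
    have hhalf : (1 / 2 : ℝ) ∈ Set.Ioo (0 : ℝ) 1 := by norm_num
    by_cases he : e.2 = 0
    · have h := pd2_eq_of_hasDerivAt (p := (1 / 2, 0)) (differentiableAt_field 0 π b 1 _ h1)
        ((hasDerivAt_const (0 : ℝ) (g (1 / 2 * e.1))).congr_of_eventuallyEq
          (Eventually.of_forall fun t => by
            simpa [he] using hg (1 / 2, t) ⟨Set.Ioo_subset_Icc_self hhalf, Set.mem_univ _⟩))
      exact (hpos (1 / 2) 0 hhalf).ne' h
    · have h := hg (1 / 2, 0) ⟨Set.Ioo_subset_Icc_self hhalf, Set.mem_univ _⟩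
      have h' := hg (0, 1 / 2 * e.1 / e.2) ⟨by simp, Set.mem_univ _⟩
      rw [(hbd _).1] at h'
      have harg : (0 : ℝ) * e.1 + 1 / 2 * e.1 / e.2 * e.2 = 1 / 2 * e.1 + 0 * e.2 := by
        field_simp
        ring
      simp only [harg] at h'
      rw [← h', field, one_mul] at h
      exact (sinEval_zero_pos (hn _) (hs _).1 (hsin hhalf)).ne' h
end
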